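/- arXiv:1308.3280 — 4 statements merged into one kernel-verified Lean document; each statement's English description precedes it below -/
import Mathlib

section
/- There is an absolute constant c > 0 such that the following holds. Let n, m, d be positive integers with d ≤ m ≤ n and let ε, δ ∈ (0, 1/3). If D is an (ε, δ) oblivious subspace embedding distribution over real m×n matrices for d-dimensional subspaces of R^n, then m ≥ c · min{n, d/ε²}. -/
open MeasureTheory ProbabilityTheory

/-- The Euclidean (ℓ₂) norm of a vector in `Fin k → ℝ`. -/
noncomputable def l2norm {k : ℕ} (v : Fin k → ℝ) : ℝ := Real.sqrt (∑ i, (v i) ^ 2)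

instance matrixMeasurableSpace {m n : ℕ} : MeasurableSpace (Matrix (Fin m) (Fin n) ℝ) :=
  (inferInstance : MeasurableSpace (Fin m → Fin n → ℝ))

/-- `D` is an `(ε, δ)` oblivious subspace embedding distribution over real `m × n`
matrices for `d`-dimensional subspaces of `ℝⁿ`. -/
def IsOSE {m n : ℕ} (d : ℕ) (ε δ : ℝ) (D : Measure (Matrix (Fin m) (Fin n) ℝ)) : Prop :=
  ∀ W : Submodule ℝ (Fin n → ℝ), Module.finrank ℝ W = d →
    ENNReal.ofReal (1 - δ) ≤
      D {Φ | ∀ x ∈ W, (1 - ε) * l2norm x ≤ l2norm (Φ.mulVec x) ∧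
               l2norm (Φ.mulVec x) ≤ (1 + ε) * l2norm x}


section ObliviousSubspaceEmbedding

open scoped Matrix

lemma Submodule.exists_le_finrank_eq {V : Type*} [AddCommGroup V] [Module ℝ V]
    [FiniteDimensional ℝ V] (W : Submodule ℝ V) {d : ℕ} (hW : Module.finrank ℝ W ≤ d)
    (hd : d ≤ Module.finrank ℝ V) : ∃ W' : Submodule ℝ V, W ≤ W' ∧ Module.finrank ℝ W' = d := by
  induction d, hW using Nat.le_induction with
  | base => exact ⟨W, le_rfl, rfl⟩
  | succ d hWd ih =>
    obtain ⟨U, hWU, hU⟩ := ih (by omega)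
    obtain ⟨v, hv⟩ : ∃ v, v ∉ U := by
      by_contra! h
      have : U = ⊤ := by ext; simp [h]
      rw [this, finrank_top] at hU
      omega
    refine ⟨U ⊔ ℝ ∙ v, hWU.trans le_sup_left, ?_⟩
    have hv0 : v ≠ 0 := fun h => hv (h ▸ U.zero_mem)
    have h1 := Submodule.finrank_sup_add_finrank_inf_eq U (ℝ ∙ v)
    have h2 : U ⊓ ℝ ∙ v = ⊥ := by
      rw [← disjoint_iff, Submodule.disjoint_span_singleton' hv0]
      exact hv
    rw [h2, finrank_bot, finrank_span_singleton hv0] at h1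
    omega

/-- The leverage scores of the row space of `Φ`. -/
lemma Matrix.exists_leverage_bound {m n : ℕ} (Φ : Matrix (Fin m) (Fin n) ℝ) :
    ∃ p : Fin n → ℝ, (∀ k, 0 ≤ p k) ∧ ∑ k, p k ≤ m ∧
      ∀ k, (Φ.col k ⬝ᵥ Φ.col k) ^ 2 ≤
        p k * ((Φ.col k ᵥ* Φ) ⬝ᵥ (Φ.col k ᵥ* Φ)) := by
  let K : Submodule ℝ (EuclideanSpace ℝ (Fin n)) :=
    LinearMap.range (Matrix.toEuclideanLin Φ.transpose)
  have hK : Module.finrank ℝ K ≤ m := by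
    simpa using LinearMap.finrank_range_le (Matrix.toEuclideanLin Φ.transpose)
  let f := stdOrthonormalBasis ℝ K
  refine ⟨fun k => ∑ j, (f j : EuclideanSpace ℝ (Fin n)) k ^ 2,
    fun k => Finset.sum_nonneg fun j _ => sq_nonneg _, ?_, fun k => ?_⟩
  · rw [Finset.sum_comm]
    have : ∀ j, ∑ k, (f j : EuclideanSpace ℝ (Fin n)) k ^ 2 = 1 := fun j => by
      rw [← EuclideanSpace.real_norm_sq_eq]
      have := f.norm_eq_one j
      rw [Submodule.coe_norm] at this
      rw [this, one_pow]
    simp only [this, Finset.sum_const, Finset.card_univ, Fintype.card_fin, nsmul_eq_mul, mul_one]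
    exact_mod_cast hK
  · let v : K := ⟨Matrix.toEuclideanLin Φ.transpose (WithLp.toLp 2 (Φ.col k)),
      LinearMap.mem_range_self _ _⟩
    have hv : ∀ l, (v : EuclideanSpace ℝ (Fin n)) l = (Φ.col k ᵥ* Φ) l := fun l => by
      simp [v, Matrix.toLpLin_apply, Matrix.mulVec_transpose]
    have h1 : Φ.col k ⬝ᵥ Φ.col k = ∑ j, f.repr v j * (f j : EuclideanSpace ℝ (Fin n)) k := by
      have : Φ.col k ⬝ᵥ Φ.col k = (v : EuclideanSpace ℝ (Fin n)) k := by
        rw [hv]; rfl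
      rw [this]
      conv_lhs => rw [← f.sum_repr v]
      simp
    have h2 : (Φ.col k ᵥ* Φ) ⬝ᵥ (Φ.col k ᵥ* Φ) = ∑ j, f.repr v j ^ 2 := by
      rw [← EuclideanSpace.real_norm_sq_eq, LinearIsometryEquiv.norm_map, Submodule.coe_norm,
        EuclideanSpace.real_norm_sq_eq]
      simp only [hv, dotProduct, pow_two]
    rw [h1, h2, mul_comm]
    exact Finset.sum_mul_sq_le_sq_mul_sq _ _ _

lemma map_dotProduct_pi_gaussianReal {n : ℕ} (b : Fin n → ℝ) :
    (Measure.pi (fun _ : Fin n => gaussianReal 0 1)).map (fun y => b ⬝ᵥ y) =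
      gaussianReal 0 (b ⬝ᵥ b).toNNReal := by
  let L : StrongDual ℝ (EuclideanSpace ℝ (Fin n)) := innerSL ℝ (WithLp.toLp 2 b)
  have h1 : (fun y : Fin n → ℝ => b ⬝ᵥ y) = L ∘ (WithLp.toLp 2) := by
    ext y
    simp [L, PiLp.inner_apply, dotProduct, mul_comm]
  have h2 : ‖L‖ ^ 2 = b ⬝ᵥ b := by
    rw [innerSL_apply_norm, EuclideanSpace.real_norm_sq_eq]
    simp only [dotProduct, pow_two]
  rw [h1, ← Measure.map_map (by fun_prop) (by fun_prop), map_pi_eq_stdGaussian,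
    IsGaussian.map_eq_gaussianReal, integral_strongDual_stdGaussian, variance_dual_stdGaussian, h2]

lemma gaussianReal_one_measureReal_Icc_le {r : ℝ} (hr : 0 ≤ r) :
    (gaussianReal 0 1).real (Set.Icc (-r) r) ≤ r := by
  have hs : (2 : ℝ) ≤ Real.sqrt (2 * Real.pi * 1) := by
    apply Real.le_sqrt_of_sq_le
    nlinarith [Real.pi_gt_three]
  have hpdf : ∀ x, gaussianPDFReal 0 1 x ≤ 1 / 2 := by
    intro x
    rw [gaussianPDFReal]
    have : Real.exp (-(x - 0) ^ 2 / (2 * (1 : NNReal))) ≤ 1 := by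
      rw [Real.exp_le_one_iff]
      rw [neg_div, neg_nonpos]
      positivity
    calc _ ≤ (Real.sqrt (2 * Real.pi * 1))⁻¹ * 1 := by
          gcongr
          simp
      _ ≤ 1 / 2 := by
          rw [mul_one, one_div]
          gcongr
  rw [measureReal_def, gaussianReal_apply_eq_integral _ one_ne_zero]
  rw [ENNReal.toReal_ofReal (integral_nonneg fun x => gaussianPDFReal_nonneg _ _ _)]
  calc _ ≤ ∫ x in Set.Icc (-r) r, (1 / 2 : ℝ) := by
        apply setIntegral_mono (integrable_gaussianPDFReal _ _).integrableOn
        · simp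
        · exact hpdf
    _ = r := by
        simp [hr]
        ring

lemma pi_gaussianReal_smallBall {n : ℕ} {b : Fin n → ℝ} {s r : ℝ} (hr : 0 ≤ r) (hb : 0 < b ⬝ᵥ b)
    (hs : s ≤ r ^ 2 * (b ⬝ᵥ b)) :
    (Measure.pi (fun _ : Fin n => gaussianReal 0 1)).real {y | (b ⬝ᵥ y) ^ 2 ≤ s} ≤ r := by
  have hv : 0 < Real.sqrt (b ⬝ᵥ b) := Real.sqrt_pos.2 hb
  set σ := Real.sqrt (b ⬝ᵥ b) with hσ
  have hσ2 : σ ^ 2 = b ⬝ᵥ b := Real.sq_sqrt hb.le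
  have hsub : {y : Fin n → ℝ | (b ⬝ᵥ y) ^ 2 ≤ s} ⊆
      (fun y => (σ⁻¹ • b) ⬝ᵥ y) ⁻¹' (Set.Icc (-r) r) := by
    intro y hy
    simp only [Set.mem_ofPred_eq] at hy
    simp only [Set.mem_preimage, Set.mem_Icc, ← abs_le, smul_dotProduct, smul_eq_mul]
    apply abs_le_of_sq_le_sq _ hr
    rw [mul_pow, inv_pow, hσ2, inv_mul_le_iff₀ hb]
    linarith
  have hm : Measurable (fun y : Fin n → ℝ => (σ⁻¹ • b) ⬝ᵥ y) := by
    unfold dotProduct; fun_prop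
  refine (measureReal_mono hsub).trans ?_
  rw [← map_measureReal_apply hm measurableSet_Icc, map_dotProduct_pi_gaussianReal]
  have : (σ⁻¹ • b) ⬝ᵥ (σ⁻¹ • b) = 1 := by
    simp only [smul_dotProduct, dotProduct_smul, smul_eq_mul, ← hσ2]
    field_simp
  rw [this, Real.toNNReal_one]
  exact gaussianReal_one_measureReal_Icc_le hr

lemma pi_gaussianReal_dotProduct_self_ge {n : ℕ} (hn : 0 < n) {K : ℝ} (hK : 0 < K) :
    (Measure.pi (fun _ : Fin n => gaussianReal 0 1)).real {y | K * n ≤ y ⬝ᵥ y} ≤ 1 / K := by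
  have hsq : Integrable (fun x : ℝ => x ^ 2) (gaussianReal 0 1) :=
    (memLp_id_gaussianReal 2).integrable_sq
  have h1 : ∫ x : ℝ, x ^ 2 ∂(gaussianReal 0 1) = 1 := by
    have := variance_fun_id_gaussianReal (μ := 0) (v := 1)
    rw [variance_eq_integral (by fun_prop)] at this
    simpa [integral_id_gaussianReal] using this
  have hint : ∀ i : Fin n, Integrable (fun y : Fin n → ℝ => y i ^ 2)
      (Measure.pi (fun _ : Fin n => gaussianReal 0 1)) := fun i =>
    integrable_comp_eval (μ := fun _ : Fin n => gaussianReal 0 1) (i := i) hsq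
  have hE : ∫ y : Fin n → ℝ, y ⬝ᵥ y ∂(Measure.pi (fun _ : Fin n => gaussianReal 0 1)) = n := by
    simp only [dotProduct, ← pow_two]
    rw [integral_finsetSum _ (fun i _ => hint i)]
    have : ∀ i : Fin n, ∫ y : Fin n → ℝ, y i ^ 2 ∂(Measure.pi (fun _ : Fin n => gaussianReal 0 1))
        = 1 := fun i => by
      rw [integral_comp_eval (μ := fun _ : Fin n => gaussianReal 0 1) (i := i)
        hsq.aestronglyMeasurable, h1]
    simp [this]
  have hI : Integrable (fun y : Fin n → ℝ => y ⬝ᵥ y)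
      (Measure.pi (fun _ : Fin n => gaussianReal 0 1)) := by
    simp only [dotProduct, ← pow_two]
    exact integrable_finsetSum _ fun i _ => hint i
  have := mul_meas_ge_le_integral_of_nonneg
    (Filter.Eventually.of_forall fun y : Fin n → ℝ => by
      simp only [dotProduct]; exact Finset.sum_nonneg fun i _ => mul_self_nonneg _) hI (K * n)
  rw [hE] at this
  have hn' : (0 : ℝ) < n := by exact_mod_cast hn
  rw [le_div_iff₀ hK]
  nlinarith

/-- The `k`-th column of `Φᵀ Φ - 1`. -/
def gramDefect {m n : ℕ} (Φ : Matrix (Fin m) (Fin n) ℝ) (k : Fin n) : Fin n → ℝ :=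
  Φ.col k ᵥ* Φ - Pi.single k 1

/-- The event that the `k`-th column of `Φ` is not short, yet `y` is nearly orthogonal to
the corresponding column of `Φᵀ Φ - 1`. -/
def CoreEvent {m n : ℕ} (Φ : Matrix (Fin m) (Fin n) ℝ) (k : Fin n) (y : Fin n → ℝ) : Prop :=
  1 / 4 ≤ Φ.col k ⬝ᵥ Φ.col k ∧ 10 ^ 6 * (m * (gramDefect Φ k ⬝ᵥ y) ^ 2) ≤ n

lemma pi_gaussianReal_coreEvent_le {m n : ℕ} (hm : 0 < m) (hmn : 4000 * m ≤ n)
    (Φ : Matrix (Fin m) (Fin n) ℝ) {p : ℝ} (k : Fin n) (hp : 0 ≤ p)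
    (hpk : (Φ.col k ⬝ᵥ Φ.col k) ^ 2 ≤ p * ((Φ.col k ᵥ* Φ) ⬝ᵥ (Φ.col k ᵥ* Φ))) :
    (Measure.pi (fun _ : Fin n => gaussianReal 0 1)).real {y | CoreEvent Φ k y} ≤
      1 / 25 + p * n / (25 * m) := by
  have hm1 : (1 : ℝ) ≤ m := by exact_mod_cast hm
  have hm0 : (0 : ℝ) < m := by linarith
  have hmn' : (4000 : ℝ) * m ≤ n := by exact_mod_cast hmn
  have hpn : 0 ≤ p * n / (25 * m) := by positivity
  by_cases hbig : 25 * m < p * n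
  · have : 1 ≤ p * n / (25 * m) := by
      rw [le_div_iff₀ (by positivity)]; linarith
    have h1 := measureReal_le_one (μ := Measure.pi (fun _ : Fin n => gaussianReal 0 1))
      (s := {y | CoreEvent Φ k y})
    linarith
  by_cases hcol : 1 / 4 ≤ Φ.col k ⬝ᵥ Φ.col k
  swap
  · have : {y | CoreEvent Φ k y} = ∅ := by
      ext y; simp only [CoreEvent, hcol, false_and]; rfl
    rw [this, measureReal_empty]
    positivity
  set a := Φ.col k ᵥ* Φ with ha
  have ha2 : n ≤ 400 * m * (a ⬝ᵥ a) := by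
    have haa : 0 ≤ a ⬝ᵥ a := Finset.sum_nonneg fun i _ => mul_self_nonneg _
    have h1 : 1 / 16 ≤ p * (a ⬝ᵥ a) := by nlinarith
    have h2 : p * n * (a ⬝ᵥ a) ≤ 25 * m * (a ⬝ᵥ a) :=
      mul_le_mul_of_nonneg_right (not_lt.1 hbig) haa
    have hn0 : (0 : ℝ) ≤ n := by positivity
    nlinarith
  have hb2 : a ⬝ᵥ a ≤ 2 * (gramDefect Φ k ⬝ᵥ gramDefect Φ k) + 2 := by
    have h1 : (Pi.single k 1 : Fin n → ℝ) ⬝ᵥ Pi.single k 1 = 1 := by simp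
    have h2 : 2 * (gramDefect Φ k ⬝ᵥ gramDefect Φ k)
        + 2 * ((Pi.single k 1 : Fin n → ℝ) ⬝ᵥ Pi.single k 1) - a ⬝ᵥ a
        = (a - (2 : ℝ) • Pi.single k 1) ⬝ᵥ (a - (2 : ℝ) • Pi.single k 1) := by
      simp only [gramDefect, ← ha, dotProduct_sub, sub_dotProduct, smul_dotProduct,
        dotProduct_smul, smul_eq_mul]
      ring
    have h3 : 0 ≤ (a - (2 : ℝ) • Pi.single k 1) ⬝ᵥ (a - (2 : ℝ) • Pi.single k 1) :=
      Finset.sum_nonneg fun i _ => mul_self_nonneg _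
    linarith
  set B := gramDefect Φ k ⬝ᵥ gramDefect Φ k with hB
  have hBn : n ≤ 1000 * m * B := by nlinarith
  have hB0 : 0 < B := by
    by_contra! h
    nlinarith
  have := pi_gaussianReal_smallBall (b := gramDefect Φ k) (s := n / (10 ^ 6 * m)) (r := 1 / 25)
    (by norm_num) hB0 (by rw [div_le_iff₀ (by positivity), ← hB]; nlinarith)
  refine (measureReal_mono fun y hy => ?_).trans (this.trans (by linarith))
  have hy := hy.2
  change (gramDefect Φ k ⬝ᵥ y) ^ 2 ≤ n / (10 ^ 6 * m)
  rw [le_div_iff₀ (by positivity)]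
  linarith

lemma sum_pi_gaussianReal_coreEvent_le {m n : ℕ} (hm : 0 < m) (hmn : 4000 * m ≤ n)
    (Φ : Matrix (Fin m) (Fin n) ℝ) :
    ∑ k, (Measure.pi (fun _ : Fin n => gaussianReal 0 1)).real {y | CoreEvent Φ k y} ≤ n / 12 := by
  obtain ⟨p, hp0, hps, hp⟩ := Matrix.exists_leverage_bound Φ
  have hm0 : (0 : ℝ) < m := by exact_mod_cast hm
  calc _ ≤ ∑ k, (1 / 25 + p k * (n / (25 * m))) := Finset.sum_le_sum fun k _ => by
        rw [← mul_div_assoc]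
        exact pi_gaussianReal_coreEvent_le hm hmn Φ k (hp0 k) (hp k)
    _ = n / 25 + (∑ k, p k) * (n / (25 * m)) := by
        rw [Finset.sum_add_distrib, Finset.sum_mul]; simp; ring
    _ ≤ n / 25 + m * (n / (25 * m)) := by gcongr
    _ ≤ n / 12 := by
        have : m * (n / (25 * m)) = (n : ℝ) / 25 := by field_simp
        have hn : (0 : ℝ) ≤ n := by positivity
        linarith

instance matrixBorelSpace {m n : ℕ} : BorelSpace (Matrix (Fin m) (Fin n) ℝ) :=
  inferInstanceAs (BorelSpace (Fin m → Fin n → ℝ))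

instance matrixSecondCountable {m n : ℕ} :
    SecondCountableTopology (Matrix (Fin m) (Fin n) ℝ) :=
  inferInstanceAs (SecondCountableTopology (Fin m → Fin n → ℝ))

/-- `Φ` distorts the squared norm of `z` by a factor at most `1 ± 3ε`. -/
def SqDistortion {m n : ℕ} (ε : ℝ) (Φ : Matrix (Fin m) (Fin n) ℝ) (z : Fin n → ℝ) : Prop :=
  |(Φ *ᵥ z) ⬝ᵥ (Φ *ᵥ z) - z ⬝ᵥ z| ≤ 3 * ε * (z ⬝ᵥ z)

lemma sqDistortion_of_l2norm {m n : ℕ} {ε : ℝ} (h0 : 0 < ε) (h1 : ε < 1 / 3)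
    {Φ : Matrix (Fin m) (Fin n) ℝ} {z : Fin n → ℝ} (hl : (1 - ε) * l2norm z ≤ l2norm (Φ *ᵥ z))
    (hu : l2norm (Φ *ᵥ z) ≤ (1 + ε) * l2norm z) : SqDistortion ε Φ z := by
  have key : ∀ {k : ℕ} (v : Fin k → ℝ), v ⬝ᵥ v = l2norm v ^ 2 := fun v => by
    rw [l2norm, Real.sq_sqrt (Finset.sum_nonneg fun i _ => sq_nonneg _)]
    simp [dotProduct, pow_two]
  have hz : 0 ≤ l2norm z := Real.sqrt_nonneg _
  have hz' : 0 ≤ l2norm (Φ *ᵥ z) := Real.sqrt_nonneg _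
  rw [SqDistortion, key, key, abs_le]
  have h2 : l2norm (Φ *ᵥ z) ^ 2 ≤ ((1 + ε) * l2norm z) ^ 2 := by gcongr
  have h3 : ((1 - ε) * l2norm z) ^ 2 ≤ l2norm (Φ *ᵥ z) ^ 2 := by
    have : 0 ≤ (1 - ε) * l2norm z := mul_nonneg (by linarith) hz
    gcongr
  constructor <;> nlinarith [mul_nonneg h0.le (sq_nonneg (l2norm z)),
    mul_nonneg (mul_nonneg h0.le (by linarith : 0 ≤ 1 - ε)) (sq_nonneg (l2norm z))]

lemma measurableSet_sqDistortion {m n : ℕ} {ι : Type*} (ε : ℝ)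
    {L : ι → (Fin n → ℝ) → Fin n → ℝ} (hL : ∀ i, Continuous (L i)) :
    MeasurableSet {ω : Matrix (Fin m) (Fin n) ℝ × (Fin n → ℝ) |
      ∀ i, SqDistortion ε ω.1 (L i ω.2)} := by
  apply IsClosed.measurableSet
  simp only [SqDistortion, Set.ofPred_forall]
  refine isClosed_iInter fun i => isClosed_le ?_ ?_ <;>
  · have := hL i
    fun_prop

lemma measurableSet_coreEvent {m n : ℕ} (k : Fin n) :
    MeasurableSet {ω : Matrix (Fin m) (Fin n) ℝ × (Fin n → ℝ) | CoreEvent ω.1 k ω.2} := by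
  apply IsClosed.measurableSet
  have hcol : Continuous fun ω : Matrix (Fin m) (Fin n) ℝ × (Fin n → ℝ) => ω.1.col k := by
    refine continuous_pi fun i => ?_
    simp only [Matrix.col_apply]
    fun_prop
  simp only [CoreEvent, gramDefect, Set.ofPred_and]
  refine (isClosed_le ?_ ?_).inter (isClosed_le ?_ ?_) <;> fun_prop

lemma IsOSE.two_thirds_le_measureReal {m n d : ℕ} {ε δ : ℝ}
    {D : Measure (Matrix (Fin m) (Fin n) ℝ)} [IsProbabilityMeasure D] (h : IsOSE d ε δ D)
    (hε0 : 0 < ε) (hε : ε < 1 / 3) (hδ : δ < 1 / 3) (hdn : d ≤ n)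
    (γ : Measure (Fin n → ℝ)) [IsProbabilityMeasure γ] {ι : Type*}
    {L : ι → (Fin n → ℝ) → Fin n → ℝ} (hL : ∀ i, Continuous (L i))
    (hW : ∀ y, ∃ W : Submodule ℝ (Fin n → ℝ), Module.finrank ℝ W ≤ d ∧ ∀ i, L i y ∈ W) :
    2 / 3 ≤ (D.prod γ).real {ω | ∀ i, SqDistortion ε ω.1 (L i ω.2)} := by
  have h1 : ENNReal.ofReal (2 / 3) ≤ (D.prod γ) {ω | ∀ i, SqDistortion ε ω.1 (L i ω.2)} := by
    rw [Measure.prod_apply_symm (measurableSet_sqDistortion ε hL)]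
    calc ENNReal.ofReal (2 / 3) = ∫⁻ _, ENNReal.ofReal (2 / 3) ∂γ := by simp
      _ ≤ _ := by
        refine lintegral_mono fun y => ?_
        obtain ⟨W, hWd, hLW⟩ := hW y
        obtain ⟨W', hWW', hW'⟩ := W.exists_le_finrank_eq hWd (by simpa using hdn)
        refine (ENNReal.ofReal_le_ofReal (by linarith)).trans ((h W' hW').trans ?_)
        refine measure_mono fun Φ hΦ i => ?_
        have := hΦ (L i y) (hWW' (hLW i))
        exact sqDistortion_of_l2norm hε0 hε this.1 this.2
  rw [measureReal_def]
  have := ENNReal.toReal_mono (measure_ne_top _ _) h1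
  rwa [ENNReal.toReal_ofReal (by norm_num)] at this

lemma sum_prod_coreEvent_le {m n : ℕ} (hm : 0 < m) (hmn : 4000 * m ≤ n)
    (D : Measure (Matrix (Fin m) (Fin n) ℝ)) [IsProbabilityMeasure D] :
    ∑ k, (D.prod (Measure.pi (fun _ : Fin n => gaussianReal 0 1))).real
      {ω | CoreEvent ω.1 k ω.2} ≤ n / 12 := by
  have hint : ∀ k : Fin n, Integrable (fun Φ : Matrix (Fin m) (Fin n) ℝ =>
      (Measure.pi (fun _ : Fin n => gaussianReal 0 1)).real {y | CoreEvent Φ k y}) D := fun k =>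
    Integrable.of_bound (measurable_measure_prodMk_left
      (measurableSet_coreEvent k)).ennreal_toReal.aestronglyMeasurable 1
      (Filter.Eventually.of_forall fun Φ => by
        rw [Real.norm_of_nonneg measureReal_nonneg]; exact measureReal_le_one)
  have : ∀ k : Fin n, (D.prod (Measure.pi (fun _ : Fin n => gaussianReal 0 1))).real
      {ω | CoreEvent ω.1 k ω.2} =
      ∫ Φ, (Measure.pi (fun _ : Fin n => gaussianReal 0 1)).real {y | CoreEvent Φ k y} ∂D :=
    fun k => by
      rw [measureReal_def, Measure.prod_apply (measurableSet_coreEvent k),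
        ← integral_toReal (measurable_measure_prodMk_left (measurableSet_coreEvent k)).aemeasurable
          (Filter.Eventually.of_forall fun Φ => measure_lt_top _ _)]
      rfl
  simp only [this]
  rw [← integral_finsetSum _ fun k _ => hint k]
  calc _ ≤ ∫ _, (n / 12 : ℝ) ∂D := integral_mono (integrable_finsetSum _ fun k _ => hint k)
        (integrable_const _) fun Φ => sum_pi_gaussianReal_coreEvent_le hm hmn Φ
    _ = n / 12 := by simp

lemma prod_dotProduct_self_ge {m n : ℕ} (hn : 0 < n)
    (D : Measure (Matrix (Fin m) (Fin n) ℝ)) [IsProbabilityMeasure D] :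
    (D.prod (Measure.pi (fun _ : Fin n => gaussianReal 0 1))).real
      {ω | 12 * (n : ℝ) ≤ ω.2 ⬝ᵥ ω.2} ≤ 1 / 12 := by
  have : {ω : Matrix (Fin m) (Fin n) ℝ × (Fin n → ℝ) | 12 * (n : ℝ) ≤ ω.2 ⬝ᵥ ω.2} =
      Set.univ ×ˢ {y | 12 * (n : ℝ) ≤ y ⬝ᵥ y} := by ext; simp
  rw [this, measureReal_prod_prod]
  simpa using pi_gaussianReal_dotProduct_self_ge hn (K := 12) (by norm_num)

lemma sum_measureReal_le_of_indicator_le {Ω ι κ : Type*} [MeasurableSpace Ω] [Fintype ι]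
    [Fintype κ] {P : Measure Ω} [IsProbabilityMeasure P] {A : ι → Set Ω} {B : κ → Set Ω}
    {Z : Set Ω} (hA : ∀ i, MeasurableSet (A i)) (hB : ∀ j, MeasurableSet (B j))
    (hZ : MeasurableSet Z) {a b c e : ℝ}
    (h : ∀ ω, a * ∑ i, (A i).indicator 1 ω ≤
      c + b * ∑ j, (B j).indicator 1 ω + e * Z.indicator 1 ω) :
    a * ∑ i, P.real (A i) ≤ c + b * ∑ j, P.real (B j) + e * P.real Z := by
  have hi : ∀ {S : Set Ω}, MeasurableSet S → Integrable (S.indicator (1 : Ω → ℝ)) P := fun hS =>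
    (integrable_const (1 : ℝ)).indicator hS
  have hsA : Integrable (fun ω => ∑ i, (A i).indicator (1 : Ω → ℝ) ω) P :=
    integrable_finsetSum _ fun i _ => hi (hA i)
  have hsB : Integrable (fun ω => ∑ j, (B j).indicator (1 : Ω → ℝ) ω) P :=
    integrable_finsetSum _ fun j _ => hi (hB j)
  have hcb : Integrable (fun ω => c + b * ∑ j, (B j).indicator (1 : Ω → ℝ) ω) P :=
    (integrable_const c).add (hsB.const_mul b)
  have key := integral_mono (hsA.const_mul a) (hcb.add ((hi hZ).const_mul e)) h
  simp only [Pi.add_apply] at key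
  rw [integral_add hcb ((hi hZ).const_mul e), integral_add (integrable_const c) (hsB.const_mul b),
    integral_const_mul, integral_const_mul, integral_const_mul,
    integral_finsetSum _ fun i _ => hi (hA i), integral_finsetSum _ fun i _ => hi (hB i)] at key
  simpa [integral_indicator_one, hA, hB, hZ] using key

lemma mulVec_dotProduct_self_add_smul {m n : ℕ} (Φ : Matrix (Fin m) (Fin n) ℝ) (k : Fin n)
    (y : Fin n → ℝ) (s t : ℝ) :
    (Φ *ᵥ (s • Pi.single k 1 + t • y)) ⬝ᵥ (Φ *ᵥ (s • Pi.single k 1 + t • y)) -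
      (s • Pi.single k 1 + t • y) ⬝ᵥ (s • Pi.single k 1 + t • y) =
    s ^ 2 * (Φ.col k ⬝ᵥ Φ.col k - 1) + 2 * (s * t) * (gramDefect Φ k ⬝ᵥ y) +
      t ^ 2 * ((Φ *ᵥ y) ⬝ᵥ (Φ *ᵥ y) - y ⬝ᵥ y) := by
  have h1 : gramDefect Φ k ⬝ᵥ y = Φ.col k ⬝ᵥ (Φ *ᵥ y) - y k := by
    rw [gramDefect, sub_dotProduct, ← Matrix.dotProduct_mulVec]; simp
  rw [h1]
  simp only [Matrix.mulVec_add, Matrix.mulVec_smul, Matrix.mulVec_single_one, dotProduct_add,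
    add_dotProduct, smul_dotProduct, dotProduct_smul, smul_eq_mul, single_one_dotProduct,
    dotProduct_single_one, Pi.add_apply, Pi.smul_apply, Pi.single_eq_same,
    dotProduct_comm (Φ *ᵥ y) (Φ.col k)]
  ring

lemma coreEvent_of_quadratic_bounds {m n : ℕ} (hm : 0 < m) {ε : ℝ}
    (hmε : m * ε ^ 2 ≤ 1 / 10 ^ 12) {Φ : Matrix (Fin m) (Fin n) ℝ} {k : Fin n} {y : Fin n → ℝ}
    (h1 : |n * (Φ.col k ⬝ᵥ Φ.col k - 1)| ≤ 1470 * ε * n)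
    (h2 : |2 * √n * (gramDefect Φ k ⬝ᵥ y)| ≤ 1470 * ε * n) : CoreEvent Φ k y := by
  have hn : (0 : ℝ) < n := by exact_mod_cast k.pos
  have hm1 : (1 : ℝ) ≤ m := by exact_mod_cast hm
  have hε1 : ε ≤ 1 / 10 ^ 6 := by
    apply le_of_sq_le_sq _ (by norm_num)
    nlinarith [sq_nonneg ε]
  constructor
  · have := (abs_le.1 h1).1
    by_contra! h
    nlinarith
  · have h3 := sq_le_sq' (abs_le.1 h2).1 (abs_le.1 h2).2
    have h4 : (2 * √n * (gramDefect Φ k ⬝ᵥ y)) ^ 2 = n * (4 * (gramDefect Φ k ⬝ᵥ y) ^ 2) := by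
      rw [mul_pow, mul_pow, Real.sq_sqrt hn.le]; ring
    have h5 : 4 * (gramDefect Φ k ⬝ᵥ y) ^ 2 ≤ 1470 ^ 2 * ε ^ 2 * n := by
      rw [h4] at h3
      refine le_of_mul_le_mul_left ?_ hn
      linarith
    have h6 : m * (4 * (gramDefect Φ k ⬝ᵥ y) ^ 2) ≤ m * (1470 ^ 2 * ε ^ 2 * n) := by gcongr
    have h7 : m * ε ^ 2 * n ≤ 1 / 10 ^ 12 * n := by gcongr
    linarith

lemma indicator_le_of_line {m n : ℕ} (hm : 0 < m) {ε : ℝ} (hε : 0 < ε)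
    (hmε : m * ε ^ 2 ≤ 1 / 10 ^ 12) (k : Fin n)
    (ω : Matrix (Fin m) (Fin n) ℝ × (Fin n → ℝ)) :
    ∑ i, {ω : Matrix (Fin m) (Fin n) ℝ × (Fin n → ℝ) | ∀ _ : Unit, SqDistortion ε ω.1
        (√n • Pi.single k 1 + (![1, -1, 2, -2] : Fin 4 → ℝ) i • ω.2)}.indicator (1 : Matrix (Fin m) (Fin n) ℝ × (Fin n → ℝ) → ℝ) ω ≤
      2 + 2 * {ω : Matrix (Fin m) (Fin n) ℝ × (Fin n → ℝ) |
          CoreEvent ω.1 k ω.2}.indicator (1 : Matrix (Fin m) (Fin n) ℝ × (Fin n → ℝ) → ℝ) ω +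
        2 * {ω : Matrix (Fin m) (Fin n) ℝ × (Fin n → ℝ) |
          12 * (n : ℝ) ≤ ω.2 ⬝ᵥ ω.2}.indicator (1 : Matrix (Fin m) (Fin n) ℝ × (Fin n → ℝ) → ℝ) ω := by
  classical
  obtain ⟨Φ, y⟩ := ω
  have hn : (0 : ℝ) < n := by exact_mod_cast k.pos
  simp only [Set.indicator_apply, Set.mem_ofPred_eq, Pi.one_apply, forall_const]
  by_cases hbig : 12 * (n : ℝ) ≤ y ⬝ᵥ y
  · rw [if_pos hbig]
    have h1 : ∀ i : Fin 4, (if SqDistortion ε Φ (√n • Pi.single k 1 +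
        (![1, -1, 2, -2] : Fin 4 → ℝ) i • y) then (1 : ℝ) else 0) ≤ 1 := fun i => by
      split_ifs <;> norm_num
    have h2 : (0 : ℝ) ≤ if CoreEvent Φ k y then 1 else 0 := by split_ifs <;> norm_num
    have := Finset.sum_le_sum fun i (_ : i ∈ Finset.univ) => h1 i
    simp only [Finset.sum_const, Finset.card_univ, Fintype.card_fin, nsmul_eq_mul] at this
    push_cast at this
    linarith
  by_cases hcore : CoreEvent Φ k y
  · rw [if_pos hcore]
    have h1 : ∀ i : Fin 4, (if SqDistortion ε Φ (√n • Pi.single k 1 +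
        (![1, -1, 2, -2] : Fin 4 → ℝ) i • y) then (1 : ℝ) else 0) ≤ 1 := fun i => by
      split_ifs <;> norm_num
    have := Finset.sum_le_sum fun i (_ : i ∈ Finset.univ) => h1 i
    simp only [Finset.sum_const, Finset.card_univ, Fintype.card_fin, nsmul_eq_mul] at this
    push_cast at this
    rw [if_neg hbig]
    linarith
  have hq : ∀ t : ℝ, t ^ 2 ≤ 4 → SqDistortion ε Φ (√n • Pi.single k 1 + t • y) →
      |n * (Φ.col k ⬝ᵥ Φ.col k - 1) + t * (2 * √n * (gramDefect Φ k ⬝ᵥ y)) +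
        t ^ 2 * ((Φ *ᵥ y) ⬝ᵥ (Φ *ᵥ y) - y ⬝ᵥ y)| ≤ 294 * ε * n := by
    intro t ht h
    rw [SqDistortion, mulVec_dotProduct_self_add_smul, Real.sq_sqrt hn.le] at h
    have hx : (√n • Pi.single k 1 + t • y : Fin n → ℝ) ⬝ᵥ (√n • Pi.single k 1 + t • y) ≤ 98 * n := by
      have e1 : (√n • Pi.single k 1 + t • y : Fin n → ℝ) ⬝ᵥ (√n • Pi.single k 1 + t • y) =
          2 * n + 2 * t ^ 2 * (y ⬝ᵥ y) -
          (√n • Pi.single k 1 - t • y : Fin n → ℝ) ⬝ᵥ (√n • Pi.single k 1 - t • y) := by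
        have hs : √(n : ℝ) * √n = n := Real.mul_self_sqrt hn.le
        simp only [dotProduct_add, add_dotProduct, dotProduct_sub, sub_dotProduct,
          smul_dotProduct, dotProduct_smul, smul_eq_mul, single_one_dotProduct,
          dotProduct_single_one, Pi.add_apply, Pi.sub_apply, Pi.smul_apply, Pi.single_eq_same]
        linear_combination 2 * hs
      have e2 : 0 ≤ (√n • Pi.single k 1 - t • y : Fin n → ℝ) ⬝ᵥ (√n • Pi.single k 1 - t • y) :=
        Finset.sum_nonneg fun i _ => mul_self_nonneg _
      have e3 : t ^ 2 * (y ⬝ᵥ y) ≤ 4 * (12 * n) := by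
        have : 0 ≤ y ⬝ᵥ y := Finset.sum_nonneg fun i _ => mul_self_nonneg _
        have := not_le.1 hbig
        gcongr
      linarith
    calc _ = _ := by congr 1; ring
      _ ≤ _ := h
      _ ≤ 3 * ε * (98 * n) := by gcongr
      _ = _ := by ring
  have hnot : ¬ (|n * (Φ.col k ⬝ᵥ Φ.col k - 1)| ≤ 1470 * ε * n ∧
      |2 * √n * (gramDefect Φ k ⬝ᵥ y)| ≤ 1470 * ε * n) := fun h =>
    hcore (coreEvent_of_quadratic_bounds hm hmε h.1 h.2)
  rw [if_neg hcore, if_neg hbig]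
  have q1 := hq 1 (by norm_num)
  have q2 := hq (-1) (by norm_num)
  have q3 := hq 2 (by norm_num)
  have q4 := hq (-2) (by norm_num)
  have hεn : 0 ≤ ε * n := by positivity
  generalize n * (Φ.col k ⬝ᵥ Φ.col k - 1) = A at *
  generalize 2 * √n * (gramDefect Φ k ⬝ᵥ y) = B at *
  generalize (Φ *ᵥ y) ⬝ᵥ (Φ *ᵥ y) - y ⬝ᵥ y = C at *
  simp only [Fin.sum_univ_four, Matrix.cons_val]
  rw [abs_le, abs_le] at hnot
  simp only [abs_le] at q1 q2 q3 q4
  clear hq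
  by_cases i1 : SqDistortion ε Φ (√n • Pi.single k 1 + (1 : ℝ) • y) <;>
    by_cases i2 : SqDistortion ε Φ (√n • Pi.single k 1 + (-1 : ℝ) • y) <;>
    by_cases i3 : SqDistortion ε Φ (√n • Pi.single k 1 + (2 : ℝ) • y) <;>
    by_cases i4 : SqDistortion ε Φ (√n • Pi.single k 1 + (-2 : ℝ) • y) <;>
    simp only [i1, i2, i3, i4, if_true, if_false, true_implies, false_implies] at q1 q2 q3 q4 ⊢ <;>
    first
    | linarith
    | exact absurd ⟨⟨by linarith, by linarith⟩, by linarith, by linarith⟩ hnot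

lemma le_sum_indicator_of_subspace {m n N : ℕ} (hN : 0 < N) {ε : ℝ} (hε : 0 < ε)
    (hε1 : ε ≤ 1 / 4) (hmε : m * ε ^ 2 ≤ 2 * N / 10 ^ 12) {k : Fin N → Fin n}
    (hk : Function.Injective k) (ω : Matrix (Fin m) (Fin n) ℝ × (Fin n → ℝ)) :
    N * ∑ _ : Unit, {ω : Matrix (Fin m) (Fin n) ℝ × (Fin n → ℝ) | ∀ p : (Fin N → ℝ) × ℝ,
        SqDistortion ε ω.1 (∑ i, p.1 i • Pi.single (k i) 1 + p.2 • ω.2)}.indicator (1 : Matrix (Fin m) (Fin n) ℝ × (Fin n → ℝ) → ℝ) ω ≤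
      0 + 2 * ∑ i, {ω : Matrix (Fin m) (Fin n) ℝ × (Fin n → ℝ) |
          CoreEvent ω.1 (k i) ω.2}.indicator (1 : Matrix (Fin m) (Fin n) ℝ × (Fin n → ℝ) → ℝ) ω +
        N * {ω : Matrix (Fin m) (Fin n) ℝ × (Fin n → ℝ) |
          12 * (n : ℝ) ≤ ω.2 ⬝ᵥ ω.2}.indicator (1 : Matrix (Fin m) (Fin n) ℝ × (Fin n → ℝ) → ℝ) ω := by
  classical
  obtain ⟨Φ, y⟩ := ω
  have hN0 : (0 : ℝ) < N := by exact_mod_cast hN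
  have hn : (0 : ℝ) < n := by exact_mod_cast (k ⟨0, hN⟩).pos
  simp only [Set.indicator_apply, Set.mem_ofPred_eq, Pi.one_apply, Finset.univ_unique,
    Finset.sum_singleton, zero_add]
  have hc0 : (0 : ℝ) ≤ ∑ i, if CoreEvent Φ (k i) y then (1 : ℝ) else 0 :=
    Finset.sum_nonneg fun i _ => by split_ifs <;> norm_num
  by_cases hbig : 12 * (n : ℝ) ≤ y ⬝ᵥ y
  · rw [if_pos hbig]
    split_ifs <;> linarith
  rw [if_neg hbig]
  split_ifs with hgood
  swap
  · linarith
  have hcol : ∀ i, 1 / 4 ≤ Φ.col (k i) ⬝ᵥ Φ.col (k i) := fun i => by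
    have := hgood (Pi.single i 1, 0)
    simp only [SqDistortion, zero_smul, add_zero] at this
    rw [Finset.sum_eq_single i (fun j _ hj => by simp [hj]) (by simp)] at this
    simp only [Pi.single_eq_same, one_smul, Matrix.mulVec_single_one, dotProduct_single_one] at this
    have := (abs_le.1 this).1
    linarith
  set g : Fin N → ℝ := fun i => gramDefect Φ (k i) ⬝ᵥ y with hg
  have hg1 : ∀ i, g i = Φ.col (k i) ⬝ᵥ (Φ *ᵥ y) - y (k i) := fun i => by
    simp only [hg]
    rw [gramDefect, sub_dotProduct, ← Matrix.dotProduct_mulVec]; simp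
  have hS : ∑ i, g i ^ 2 ≤ 9 * ε ^ 2 * (y ⬝ᵥ y) := by
    set τ := 1 / (3 * ε) with hτ
    have hτε : 3 * ε * τ = 1 := by rw [hτ]; field_simp
    set u : Fin n → ℝ := ∑ i, (τ * g i) • Pi.single (k i) 1 with hu
    have p1 := hgood (fun i => τ * g i, 1)
    have p2 := hgood (fun i => τ * g i, -1)
    simp only [SqDistortion, ← hu, one_smul, neg_one_smul] at p1 p2
    have huu : u ⬝ᵥ u = τ ^ 2 * ∑ i, g i ^ 2 := by
      have hui : ∀ i, u (k i) = τ * g i := fun i => by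
        rw [hu, Finset.sum_apply, Finset.sum_eq_single i]
        · simp
        · intro j _ hj
          simp [hk.ne hj.symm]
        · simp
      nth_rewrite 1 [hu]
      rw [sum_dotProduct]
      simp only [smul_dotProduct, single_one_dotProduct, hui, Finset.mul_sum, smul_eq_mul]
      exact Finset.sum_congr rfl fun i _ => by ring
    have huy : (Φ *ᵥ u) ⬝ᵥ (Φ *ᵥ y) - u ⬝ᵥ y = τ * ∑ i, g i ^ 2 := by
      rw [hu, Matrix.mulVec_sum, sum_dotProduct, sum_dotProduct, ← Finset.sum_sub_distrib,
        Finset.mul_sum]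
      refine Finset.sum_congr rfl fun i _ => ?_
      simp only [Matrix.mulVec_smul, smul_dotProduct, Matrix.mulVec_single_one,
        single_one_dotProduct, smul_eq_mul]
      rw [← mul_sub, ← hg1]; ring
    simp only [← sub_eq_add_neg, Matrix.mulVec_add, Matrix.mulVec_sub, dotProduct_add,
      add_dotProduct, dotProduct_sub, sub_dotProduct, dotProduct_comm (Φ *ᵥ y) (Φ *ᵥ u),
      dotProduct_comm y u, huu] at p1 p2
    have r1 := (abs_le.1 p1).2
    have r2 := (abs_le.1 p2).1
    set S := ∑ i, g i ^ 2 with hSdef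
    have h4 : 4 * (τ * S) ≤ 6 * ε * (τ ^ 2 * S + y ⬝ᵥ y) := by linarith
    have h5 : 6 * ε * (τ ^ 2 * S) = 2 * (τ * S) := by linear_combination 2 * τ * S * hτε
    have h6 : τ * S ≤ 3 * ε * (y ⬝ᵥ y) := by linarith
    calc S = 3 * ε * (τ * S) := by linear_combination -S * hτε
      _ ≤ 3 * ε * (3 * ε * (y ⬝ᵥ y)) := by gcongr
      _ = _ := by ring
  have hpt : ∀ i, (1 - if CoreEvent Φ (k i) y then (1 : ℝ) else 0) * n ≤
      10 ^ 6 * (m * g i ^ 2) := fun i => by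
    split_ifs with hc
    · rw [sub_self, zero_mul]; positivity
    · have : ¬ (10 ^ 6 * (m * g i ^ 2) ≤ (n : ℝ)) := fun h => hc ⟨hcol i, h⟩
      linarith
  have hsum := Finset.sum_le_sum fun i (_ : i ∈ Finset.univ) => hpt i
  rw [← Finset.sum_mul, ← Finset.mul_sum, ← Finset.mul_sum, Finset.sum_sub_distrib] at hsum
  simp only [Finset.sum_const, Finset.card_univ, Fintype.card_fin, nsmul_eq_mul, mul_one] at hsum ⊢
  have hyn := (not_le.1 hbig).le
  have h1 : m * ∑ i, g i ^ 2 ≤ 108 * (2 * N / 10 ^ 12) * n := by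
    calc m * ∑ i, g i ^ 2 ≤ m * (9 * ε ^ 2 * (12 * n)) := by
          gcongr
          exact hS.trans (by gcongr)
      _ = 108 * (m * ε ^ 2) * n := by ring
      _ ≤ _ := by gcongr
  have h2 : ((N : ℝ) - ∑ i, if CoreEvent Φ (k i) y then (1 : ℝ) else 0) * n ≤ N / 2 * n := by
    have : 0 ≤ (N : ℝ) * n := by positivity
    linarith
  have := le_of_mul_le_mul_right h2 hn
  linarith

lemma measurableSet_dotProduct_self_ge {m n : ℕ} (c : ℝ) :
    MeasurableSet {ω : Matrix (Fin m) (Fin n) ℝ × (Fin n → ℝ) | c ≤ ω.2 ⬝ᵥ ω.2} := by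
  apply IsClosed.measurableSet
  refine isClosed_le ?_ ?_ <;> fun_prop

lemma IsOSE.lt_mul_sq_of_one {m n : ℕ} {ε δ : ℝ} {D : Measure (Matrix (Fin m) (Fin n) ℝ)}
    [IsProbabilityMeasure D] (h : IsOSE 1 ε δ D) (hε0 : 0 < ε) (hε : ε < 1 / 3) (hδ : δ < 1 / 3)
    (hm : 0 < m) (hmn : 4000 * m ≤ n) : 1 / 10 ^ 12 < m * ε ^ 2 := by
  by_contra! hmε
  have hn : 0 < n := by omega
  have hn0 : (0 : ℝ) < n := by exact_mod_cast hn
  have hZ := prod_dotProduct_self_ge hn D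
  have hk : ∀ k : Fin n, 1 / 4 ≤ (D.prod (Measure.pi (fun _ : Fin n => gaussianReal 0 1))).real
      {ω | CoreEvent ω.1 k ω.2} := fun k => by
    have hcont : ∀ i, ∀ _ : Unit, Continuous fun y : Fin n → ℝ =>
        √n • Pi.single k 1 + (![1, -1, 2, -2] : Fin 4 → ℝ) i • y := fun i _ => by fun_prop
    have h1 := sum_measureReal_le_of_indicator_le (a := 1) (b := 2) (c := 2) (e := 2)
      (P := D.prod (Measure.pi (fun _ : Fin n => gaussianReal 0 1)))
      (fun i => measurableSet_sqDistortion ε (hcont i))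
      (fun _ : Unit => measurableSet_coreEvent k)
      (measurableSet_dotProduct_self_ge (12 * n))
      (fun ω => by
        simpa using indicator_le_of_line hm hε0 hmε k ω)
    have h2 := Finset.sum_le_sum fun i (_ : i ∈ Finset.univ) =>
      h.two_thirds_le_measureReal hε0 hε hδ hn
        (Measure.pi (fun _ : Fin n => gaussianReal 0 1)) (hcont i) fun y =>
        ⟨Submodule.span ℝ {_}, (finrank_span_le_card _).trans (by simp),
          fun _ => Submodule.subset_span rfl⟩
    simp only [Finset.sum_const, Finset.card_univ, Fintype.card_fin, nsmul_eq_mul,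
      Finset.univ_unique, Finset.card_singleton, Nat.cast_one, one_mul] at h1 h2
    push_cast at h2
    linarith
  have h3 := Finset.sum_le_sum fun k (_ : k ∈ Finset.univ) => hk k
  have h4 := sum_prod_coreEvent_le hm hmn D
  simp only [Finset.sum_const, Finset.card_univ, Fintype.card_fin, nsmul_eq_mul] at h3
  linarith

lemma IsOSE.lt_mul_sq_of_succ {m n N : ℕ} {ε δ : ℝ} {D : Measure (Matrix (Fin m) (Fin n) ℝ)}
    [IsProbabilityMeasure D] (h : IsOSE (N + 1) ε δ D) (hN : 0 < N) (hNn : N + 1 ≤ n)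
    (hε0 : 0 < ε) (hε : ε ≤ 1 / 4) (hδ : δ < 1 / 3) (hm : 0 < m) (hmn : 4000 * m ≤ n) :
    2 * N / 10 ^ 12 < m * ε ^ 2 := by
  by_contra! hmε
  have hn : 0 < n := by omega
  have hn0 : (0 : ℝ) < n := by exact_mod_cast hn
  have hN0 : (0 : ℝ) < N := by exact_mod_cast hN
  have : NeZero n := ⟨hn.ne'⟩
  have hZ := prod_dotProduct_self_ge hn D
  have hs : ∀ s : Fin n, N * (7 / 24 : ℝ) ≤
      ∑ i : Fin N, (D.prod (Measure.pi (fun _ : Fin n => gaussianReal 0 1))).real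
        {ω | CoreEvent ω.1 (i.castLE (by omega) + s) ω.2} := fun s => by
    have hinj : Function.Injective fun i : Fin N => (i.castLE (by omega) : Fin n) + s :=
      (add_left_injective s).comp (Fin.castLE_injective _)
    have hcont : ∀ p : (Fin N → ℝ) × ℝ, Continuous fun y : Fin n → ℝ =>
        ∑ i, p.1 i • Pi.single ((i.castLE (by omega) : Fin n) + s) 1 + p.2 • y := fun p => by
      fun_prop
    have h1 := sum_measureReal_le_of_indicator_le (a := N) (b := 2) (c := 0) (e := N)
      (P := D.prod (Measure.pi (fun _ : Fin n => gaussianReal 0 1)))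
      (fun _ : Unit => measurableSet_sqDistortion ε hcont)
      (fun i : Fin N => measurableSet_coreEvent ((i.castLE (by omega) : Fin n) + s))
      (measurableSet_dotProduct_self_ge (12 * n))
      (fun ω => le_sum_indicator_of_subspace hN hε0 hε hmε hinj ω)
    have h2 := h.two_thirds_le_measureReal hε0 (by linarith) hδ hNn
        (Measure.pi (fun _ : Fin n => gaussianReal 0 1)) hcont fun y =>
        ⟨Submodule.span ℝ (Set.range fun i : Fin N =>
            (Pi.single ((i.castLE (by omega) : Fin n) + s) 1 : Fin n → ℝ)) ⊔ Submodule.span ℝ {y},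
          (Submodule.finrank_add_le_finrank_add_finrank _ _).trans (add_le_add
            ((finrank_range_le_card _).trans (by simp))
            ((finrank_span_le_card _).trans (by simp))),
          fun p => Submodule.add_mem_sup
            (Submodule.sum_mem _ fun i _ => Submodule.smul_mem _ _
              (Submodule.subset_span ⟨i, rfl⟩))
            (Submodule.smul_mem _ _ (Submodule.subset_span rfl))⟩
    simp only [Finset.univ_unique, Finset.sum_singleton] at h1
    have h3 := mul_le_mul_of_nonneg_left h2 hN0.le
    have h4 := mul_le_mul_of_nonneg_left hZ hN0.le
    linarith
  have h3 := Finset.sum_le_sum fun s (_ : s ∈ Finset.univ) => hs s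
  have h4 := sum_prod_coreEvent_le hm hmn D
  rw [Finset.sum_comm] at h3
  have h5 : ∀ i : Fin N, ∑ s : Fin n,
      (D.prod (Measure.pi (fun _ : Fin n => gaussianReal 0 1))).real
        {ω | CoreEvent ω.1 (i.castLE (by omega) + s) ω.2} ≤ n / 12 := fun i =>
    (Equiv.sum_comp (Equiv.addLeft (i.castLE (by omega) : Fin n)) fun k : Fin n =>
      (D.prod (Measure.pi (fun _ : Fin n => gaussianReal 0 1))).real
        {ω | CoreEvent ω.1 k ω.2}).trans_le h4
  have h6 := Finset.sum_le_sum fun i (_ : i ∈ Finset.univ) => h5 i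
  simp only [Finset.sum_const, Finset.card_univ, Fintype.card_fin, nsmul_eq_mul] at h3 h6
  have : 0 < (N : ℝ) * n := by positivity
  linarith

end ObliviousSubspaceEmbedding

theorem stmt0 :
    ∃ c : ℝ, 0 < c ∧
      ∀ (n m d : ℕ) (ε δ : ℝ) (D : Measure (Matrix (Fin m) (Fin n) ℝ)),
        IsProbabilityMeasure D →
        0 < d → d ≤ m → m ≤ n →
        ε ∈ Set.Ioo (0:ℝ) (1/3) → δ ∈ Set.Ioo (0:ℝ) (1/3) →
        IsOSE d ε δ D →
        c * min (n : ℝ) ((d : ℝ) / ε ^ 2) ≤ (m : ℝ) := by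
  refine ⟨1 / 10 ^ 12, by norm_num, ?_⟩
  intro n m d ε δ D hD hd hdm hmn hε hδ h
  by_contra! hlt
  have hm : 0 < m := by omega
  have hm0 : (0 : ℝ) < m := by exact_mod_cast hm
  have hε2 : 0 < ε ^ 2 := pow_pos hε.1 2
  have h1 : (m : ℝ) < 1 / 10 ^ 12 * n :=
    hlt.trans_le (mul_le_mul_of_nonneg_left (min_le_left _ _) (by norm_num))
  have h2 : (m : ℝ) < 1 / 10 ^ 12 * (d / ε ^ 2) :=
    hlt.trans_le (mul_le_mul_of_nonneg_left (min_le_right _ _) (by norm_num))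
  rw [← mul_div_assoc, lt_div_iff₀ hε2] at h2
  have hmn' : 4000 * m ≤ n := by
    have : (4000 : ℝ) * m ≤ n := by linarith
    exact_mod_cast this
  have hdm' : (d : ℝ) ≤ m := by exact_mod_cast hdm
  have hε1 : ε ≤ 1 / 4 := by
    have : ε ^ 2 ≤ 1 / 10 ^ 12 := by
      refine le_of_mul_le_mul_left ?_ hm0
      linarith
    apply le_of_sq_le_sq _ (by norm_num)
    linarith
  obtain ⟨N, rfl⟩ : ∃ N, d = N + 1 := ⟨d - 1, by omega⟩
  rcases Nat.eq_zero_or_pos N with rfl | hN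
  · have := h.lt_mul_sq_of_one hε.1 hε.2 hδ.2 hm hmn'
    norm_num at h2 this
    linarith
  · have := h.lt_mul_sq_of_succ hN (by omega) hε.1 hε1 hδ.2 hm hmn'
    have hN1 : (1 : ℝ) ≤ N := by exact_mod_cast hN
    push_cast at h2
    linarith
end

section
/- There is an absolute constant c > 0 such that the following holds. Let n, m, d be positive integers with d ≤ m ≤ n and let ε, δ ∈ (0, 1/3). If D is an (ε, δ) oblivious subspace embedding distribution over real m×n matrices for d-dimensional subspaces of R^n, then m ≥ c · min{n, ε⁻² · log(d/δ)}. -/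
open MeasureTheory ProbabilityTheory

section Stretch

variable {E : Type*} [NormedAddCommGroup E] [InnerProductSpace ℝ E]

/-- The map multiplying the component along `V` by `1 + a` and fixing `Vᗮ`. -/
noncomputable def stretch [FiniteDimensional ℝ E] (V : Submodule ℝ E) (a : ℝ) : E →ₗ[ℝ] E :=
  LinearMap.id + a • (V.starProjection : E →ₗ[ℝ] E)

variable [FiniteDimensional ℝ E] (V : Submodule ℝ E)

theorem stretch_apply (a : ℝ) (y : E) : stretch V a y = y + a • V.starProjection y := rfl

theorem det_stretch (a : ℝ) :
    LinearMap.det (stretch V a) = (1 + a) ^ Module.finrank ℝ V := by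
  have hV : ∀ y ∈ V, stretch V a y = (1 + a) • y := fun y hy => by
    rw [stretch_apply, Submodule.starProjection_eq_self_iff.2 hy, add_smul, one_smul]
  have h : V ≤ V.comap (stretch V a) := fun y hy => by
    rw [Submodule.mem_comap, hV y hy]
    exact V.smul_mem _ hy
  rw [LinearMap.det_eq_det_mul_det V _ h]
  have h1 : (stretch V a).restrict h = (1 + a) • LinearMap.id := by
    ext y
    simpa using hV y y.2
  have h2 : V.mapQ V (stretch V a) h = LinearMap.id := by
    ext y
    simp only [LinearMap.comp_apply, Submodule.mkQ_apply, Submodule.mapQ_apply, LinearMap.id_apply]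
    rw [Submodule.Quotient.eq, stretch_apply, add_sub_cancel_left]
    exact V.smul_mem _ (V.starProjection_apply_mem y)
  rw [h1, h2]
  simp

theorem norm_stretch_sq (a : ℝ) (y : E) :
    ‖stretch V a y‖ ^ 2 = ‖y‖ ^ 2 + (2 * a + a ^ 2) * ‖V.starProjection y‖ ^ 2 := by
  have h : inner ℝ y (V.starProjection y) = ‖V.starProjection y‖ ^ 2 := by
    have := V.starProjection_inner_eq_zero y _ (V.starProjection_apply_mem y)
    rw [inner_sub_left, real_inner_self_eq_norm_sq] at this
    linarith
  rw [stretch_apply, norm_add_sq_real, inner_smul_right, norm_smul, mul_pow, h,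
    Real.norm_eq_abs, sq_abs]
  ring

theorem map_stretch {F : Type*} [AddCommGroup F] [Module ℝ F] (L : E →ₗ[ℝ] F)
    (hV : V = (LinearMap.ker L)ᗮ) (a : ℝ) (y : E) :
    L (stretch V a y) = (1 + a) • L y := by
  have h : L (V.starProjection y) = L y := by
    have := V.sub_starProjection_mem_orthogonal y
    rw [hV, Submodule.orthogonal_orthogonal, LinearMap.mem_ker, map_sub, sub_eq_zero] at this
    rw [hV, ← this]
  rw [stretch_apply, map_add, map_smul, h, add_smul, one_smul]

variable [MeasurableSpace E] [BorelSpace E]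

/-- If the stretch maps `G` into the part of a cone `S` of norm at most `ρ`, then the volume of
`G` is controlled by that of `S` in the unit ball. -/
theorem volume_le_of_stretch {S G : Set E} (hS : ∀ c : ℝ, 0 < c → ∀ x ∈ S, c • x ∈ S)
    {a ρ : ℝ} (ha : -1 < a) (hρ : 0 < ρ)
    (hG : ∀ y ∈ G, stretch V a y ∈ S ∧ ‖stretch V a y‖ ≤ ρ) :
    (1 + a) ^ Module.finrank ℝ V * volume.real G ≤
      ρ ^ Module.finrank ℝ E * volume.real (S ∩ Metric.closedBall 0 1) := by
  have hsub : (ρ⁻¹ • stretch V a) '' G ⊆ S ∩ Metric.closedBall 0 1 := by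
    rintro _ ⟨y, hy, rfl⟩
    obtain ⟨h1, h2⟩ := hG y hy
    refine ⟨hS _ (inv_pos.2 hρ) _ h1, ?_⟩
    rw [mem_closedBall_zero_iff, LinearMap.smul_apply, norm_smul, norm_inv, Real.norm_of_nonneg hρ.le]
    rw [inv_mul_le_iff₀ hρ]
    simpa using h2
  have hfin : volume (S ∩ Metric.closedBall (0 : E) 1) ≠ ⊤ :=
    ((measure_mono Set.inter_subset_right).trans_lt
      (isCompact_closedBall (0 : E) 1).measure_lt_top).ne
  have h := measureReal_mono hsub hfin
  rw [measureReal_def, Measure.addHaar_image_linearMap, LinearMap.det_smul, det_stretch,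
    ENNReal.toReal_mul, ENNReal.toReal_ofReal (abs_nonneg _), ← measureReal_def,
    abs_of_pos (by have : 0 < 1 + a := by linarith
                   positivity)] at h
  rw [inv_pow, mul_assoc, inv_mul_le_iff₀ (by positivity)] at h
  exact h

end Stretch

theorem exists_le_submodule_finrank_eq {K E : Type*} [Field K] [AddCommGroup E] [Module K E]
    [FiniteDimensional K E] (U : Submodule K E) {k : ℕ} (hU : Module.finrank K U ≤ k)
    (hk : k ≤ Module.finrank K E) : ∃ W, U ≤ W ∧ Module.finrank K W = k := by
  induction k, hU using Nat.le_induction with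
  | base => exact ⟨U, le_rfl, rfl⟩
  | succ k _ ih =>
    obtain ⟨W, hUW, hW⟩ := ih (by omega)
    have : ∃ x, x ∉ W := by
      by_contra! h
      have : W = ⊤ := by ext; simp [h]
      rw [this, finrank_top] at hW
      omega
    obtain ⟨x, hx⟩ := this
    refine ⟨W ⊔ K ∙ x, hUW.trans le_sup_left, ?_⟩
    rw [Submodule.finrank_sup_span_singleton hx, hW]

section Concentration

variable {E : Type*} [NormedAddCommGroup E] [InnerProductSpace ℝ E] [FiniteDimensional ℝ E]
  [MeasurableSpace E] [BorelSpace E]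

/-- In the unit ball, the squared length of the projection onto a subspace `V` exceeds its mean
by a multiple of the standard deviation only with small probability. -/
theorem volume_large_projection_le (V : Submodule ℝ E) {m : ℕ} (hm : 0 < m)
    (hV : Module.finrank ℝ V ≤ m) {θ : ℝ}
    (hθ : θ * Module.finrank ℝ E = Module.finrank ℝ V + 10 * √(m : ℝ)) :
    volume.real {y : E | ‖y‖ ≤ 1 ∧ θ * ‖y‖ ^ 2 ≤ ‖V.starProjection y‖ ^ 2} ≤
      1 / 10 * volume.real (Metric.closedBall (0 : E) 1) := by
  set r := Module.finrank ℝ V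
  set n := Module.finrank ℝ E
  set s := √(m : ℝ) with hs
  have hm1 : (1 : ℝ) ≤ m := by exact_mod_cast hm
  have hs1 : 1 ≤ s := Real.one_le_sqrt.2 hm1
  have hss : s ^ 2 = m := Real.sq_sqrt (by positivity)
  have hrm : (r : ℝ) ≤ m := by exact_mod_cast hV
  obtain ⟨b, hb⟩ : ∃ b, b = 1 / (2 * s) := ⟨_, rfl⟩
  have hbs : b * s = 1 / 2 := by rw [hb]; field_simp
  have hb0 : 0 < b := by rw [hb]; positivity
  have hb2 : b ≤ 1 / 2 := by nlinarith
  obtain ⟨u, hu⟩ : ∃ u, u = 2 * b - b ^ 2 := ⟨_, rfl⟩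
  have hu0 : 0 ≤ u := by rw [hu]; nlinarith
  have key := volume_le_of_stretch V (S := Set.univ)
    (G := {y : E | ‖y‖ ≤ 1 ∧ θ * ‖y‖ ^ 2 ≤ ‖V.starProjection y‖ ^ 2})
    (fun _ _ _ _ => trivial) (a := -b) (ρ := Real.exp (-(u * θ / 2))) (by linarith)
    (Real.exp_pos _) (fun y ⟨hy1, hy2⟩ => ⟨trivial, by
      refine (sq_le_sq₀ (norm_nonneg _) (Real.exp_pos _).le).1 ?_
      rw [norm_stretch_sq, ← Real.exp_nat_mul]
      have h1 := Real.add_one_le_exp (-(u * θ))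
      have h2 : ((2 : ℕ) : ℝ) * -(u * θ / 2) = -(u * θ) := by push_cast; ring
      rw [h2]
      by_cases h3 : 1 - u * θ ≤ 0
      · have h4 : ‖y‖ ^ 2 ≤ u * θ * ‖y‖ ^ 2 := by nlinarith [sq_nonneg ‖y‖]
        nlinarith [Real.exp_pos (-(u * θ))]
      · have h4 : ‖y‖ ^ 2 ≤ 1 := by nlinarith [norm_nonneg y]
        nlinarith⟩)
  rw [Set.univ_inter, ← Real.exp_nat_mul] at key
  have hlog : Real.exp (-(b + 2 * b ^ 2) * r) ≤ (1 + -b) ^ r := by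
    rw [← Real.exp_log (show 0 < 1 + -b by linarith), ← Real.exp_nat_mul, mul_comm (r : ℝ)]
    apply Real.exp_le_exp.2
    apply mul_le_mul_of_nonneg_right _ (by positivity)
    refine le_trans ?_ (Real.one_sub_inv_le_log_of_pos (show 0 < 1 + -b by linarith))
    have : (1 + -b)⁻¹ ≤ 1 + (b + 2 * b ^ 2) := by
      rw [inv_le_iff_one_le_mul₀ (by linarith)]
      nlinarith
    linarith
  set x := volume.real {y : E | ‖y‖ ≤ 1 ∧ θ * ‖y‖ ^ 2 ≤ ‖V.starProjection y‖ ^ 2}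
  set w := volume.real (Metric.closedBall (0 : E) 1)
  have hx : 0 ≤ x := measureReal_nonneg
  have hw : 0 ≤ w := measureReal_nonneg
  have h1 : Real.exp (-(b + 2 * b ^ 2) * r) * x ≤ Real.exp (n * -(u * θ / 2)) * w :=
    (mul_le_mul_of_nonneg_right hlog hx).trans key
  have h2 : x ≤ Real.exp ((b + 2 * b ^ 2) * r + n * -(u * θ / 2)) * w := by
    rw [Real.exp_add, mul_assoc]
    refine le_trans (le_of_eq ?_) (mul_le_mul_of_nonneg_left h1 (Real.exp_pos _).le)
    rw [← mul_assoc, ← Real.exp_add]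
    ring_nf
    simp
  have h3 : (b + 2 * b ^ 2) * r + n * -(u * θ / 2) ≤ -3 := by
    have e : n * -(u * θ / 2) = -(b - b ^ 2 / 2) * (r + 10 * s) := by
      rw [← hθ, hu]; ring
    have e2 : b ^ 2 * m = 1 / 4 := by rw [← hss, ← mul_pow, hbs]; norm_num
    rw [e]
    have e3 : b ^ 2 * r ≤ 1 / 4 := e2 ▸ mul_le_mul_of_nonneg_left hrm (sq_nonneg b)
    have e4 : b ^ 2 * s ≤ 1 / 4 := by
      have : b ^ 2 * s = b * (b * s) := by ring
      rw [this, hbs]; linarith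
    nlinarith
  refine h2.trans (mul_le_mul_of_nonneg_right ((Real.exp_le_exp.2 h3).trans ?_) hw)
  have h4 := Real.exp_one_gt_d9
  have h5 : Real.exp 3 = Real.exp 1 ^ 3 := by rw [← Real.exp_nat_mul]; norm_num
  rw [Real.exp_neg, inv_le_comm₀ (Real.exp_pos _) (by norm_num), h5]
  have : (2.7 : ℝ) ^ 3 ≤ Real.exp 1 ^ 3 := by gcongr; linarith
  norm_num at this ⊢
  linarith

theorem distortion_lt {ε θ x y z : ℝ} (hε : 0 < ε) (hε3 : ε < 1 / 3) (hθ0 : 0 ≤ θ)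
    (hθ1 : θ ≤ 1 / 10) (hy : 0 < y) (hx : 0 ≤ x)
    (hle : x ^ 2 ≤ (1 + 2 * ((8 * ε + (8 * ε) ^ 2 / 2) * θ)) * y ^ 2) (hz : (1 - ε) * y ≤ z) :
    (1 + ε) * x < (1 + 8 * ε) * z := by
  obtain ⟨v, hv⟩ : ∃ v, v = (8 * ε + (8 * ε) ^ 2 / 2) * θ := ⟨_, rfl⟩
  rw [← hv] at hle
  have hv0 : 0 ≤ v := by rw [hv]; positivity
  have hle' : x ≤ (1 + v) * y := by
    refine (sq_le_sq₀ hx (by positivity)).1 ?_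
    rw [mul_pow]
    exact hle.trans (mul_le_mul_of_nonneg_right (by nlinarith) (sq_nonneg _))
  have hv2 : v ≤ 2 * ε := by
    have : v ≤ (8 * ε + (8 * ε) ^ 2 / 2) * (1 / 10) := by
      rw [hv]; exact mul_le_mul_of_nonneg_left hθ1 (by positivity)
    nlinarith
  calc (1 + ε) * x ≤ (1 + ε) * ((1 + 2 * ε) * y) := by
        refine mul_le_mul_of_nonneg_left (hle'.trans ?_) (by linarith)
        exact mul_le_mul_of_nonneg_right (by linarith) hy.le
    _ = (1 + ε) * (1 + 2 * ε) * y := by ring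
    _ < (1 + 8 * ε) * (1 - ε) * y := mul_lt_mul_of_pos_right (by nlinarith) hy
    _ = (1 + 8 * ε) * ((1 - ε) * y) := by ring
    _ ≤ _ := mul_le_mul_of_nonneg_left hz (by linarith)

/-- A linear map of rank at most `m`, far below the dimension of its domain, distorts the norm of
a non-negligible fraction of the points of the unit ball. -/
theorem exp_le_of_volume_distorted_le {F : Type*} [NormedAddCommGroup F] [NormedSpace ℝ F]
    (L : E →ₗ[ℝ] F) {m : ℕ} (hm : 0 < m) (hr : Module.finrank ℝ (LinearMap.ker L)ᗮ ≤ m)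
    (hn : 110 * m ≤ Module.finrank ℝ E) {ε p : ℝ} (hε : 0 < ε) (hε3 : ε < 1 / 3)
    (hp : p < 1 / 3)
    (hbad : volume.real ({x : E | (1 - ε) * ‖x‖ ≤ ‖L x‖ ∧ ‖L x‖ ≤ (1 + ε) * ‖x‖}ᶜ ∩
      Metric.closedBall 0 1) ≤ p * volume.real (Metric.closedBall (0 : E) 1)) :
    17 / 30 * Real.exp (-(96 * (ε * √(m : ℝ)) ^ 2 + 187 * (ε * √(m : ℝ)))) ≤ p := by
  set V := (LinearMap.ker L)ᗮ with hV
  set r := Module.finrank ℝ V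
  set n := Module.finrank ℝ E with hn_def
  set s := √(m : ℝ) with hs
  set S := {x : E | (1 - ε) * ‖x‖ ≤ ‖L x‖ ∧ ‖L x‖ ≤ (1 + ε) * ‖x‖} with hS
  have hm1 : (1 : ℝ) ≤ m := by exact_mod_cast hm
  have hs1 : 1 ≤ s := Real.one_le_sqrt.2 hm1
  have hss : s ^ 2 = m := Real.sq_sqrt (by positivity)
  have hrm : (r : ℝ) ≤ m := by exact_mod_cast hr
  have hnm : 110 * (m : ℝ) ≤ n := by exact_mod_cast hn
  have hn0 : (0 : ℝ) < n := by linarith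
  obtain ⟨θ, hθ⟩ : ∃ θ : ℝ, θ = (r + 10 * s) / n := ⟨_, rfl⟩
  have hθn : θ * n = r + 10 * s := by rw [hθ]; field_simp
  have hθ0 : 0 ≤ θ := by rw [hθ]; positivity
  have hθ1 : θ ≤ 1 / 10 := by
    rw [hθ, div_le_iff₀ hn0]
    nlinarith
  have tail := volume_large_projection_le V hm hr hθn
  set A := {y : E | ‖y‖ ≤ 1 ∧ θ * ‖y‖ ^ 2 ≤ ‖V.starProjection y‖ ^ 2}
  set B := Metric.closedBall (0 : E) 1
  set G := {y : E | ‖y‖ ≤ 1 ∧ y ∈ S ∧ ‖V.starProjection y‖ ^ 2 < θ * ‖y‖ ^ 2} with hG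
  have hBfin : volume B ≠ ⊤ := (isCompact_closedBall (0 : E) 1).measure_lt_top.ne
  have hB0 : 0 < volume.real B :=
    ENNReal.toReal_pos (Metric.measure_closedBall_pos volume _ one_pos).ne' hBfin
  have hcover : B ⊆ (Sᶜ ∩ B) ∪ A ∪ G := by
    intro y hy
    have hy1 : ‖y‖ ≤ 1 := mem_closedBall_zero_iff.1 hy
    by_cases h1 : y ∈ S
    · by_cases h2 : θ * ‖y‖ ^ 2 ≤ ‖V.starProjection y‖ ^ 2
      · exact Or.inl (Or.inr ⟨hy1, h2⟩)
      · exact Or.inr ⟨hy1, h1, not_le.1 h2⟩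
    · exact Or.inl (Or.inl ⟨h1, hy⟩)
  have hsub : (Sᶜ ∩ B) ∪ A ∪ G ⊆ B := by
    rintro y ((h | h) | h)
    · exact h.2
    · exact mem_closedBall_zero_iff.2 h.1
    · exact mem_closedBall_zero_iff.2 h.1
  have hvol : volume.real B ≤ volume.real (Sᶜ ∩ B) + volume.real A + volume.real G := by
    refine (measureReal_mono hcover ((measure_mono hsub).trans_lt hBfin.lt_top).ne).trans ?_
    refine (measureReal_union_le _ _).trans ?_
    gcongr
    exact measureReal_union_le _ _
  have hGlow : 17 / 30 * volume.real B ≤ volume.real G := by nlinarith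
  obtain ⟨a, ha⟩ : ∃ a, a = 8 * ε := ⟨_, rfl⟩
  have ha0 : 0 < a := by linarith
  have hcone : ∀ c : ℝ, 0 < c → ∀ x ∈ Sᶜ, c • x ∈ Sᶜ := by
    intro c hc x hx hcx
    apply hx
    obtain ⟨h1, h2⟩ := hcx
    rw [map_smul, norm_smul, norm_smul, Real.norm_of_nonneg hc.le] at h1 h2
    constructor
    · exact le_of_mul_le_mul_left (by linarith) hc
    · exact le_of_mul_le_mul_left (by linarith) hc
  have key := volume_le_of_stretch V (G := G) hcone (a := a)
    (ρ := Real.exp ((a + a ^ 2 / 2) * θ)) (by linarith) (Real.exp_pos _)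
    fun y ⟨hy1, ⟨hy2, _⟩, hy3⟩ => by
      have hsq := norm_stretch_sq V a y
      have hy0 : 0 < ‖y‖ := by
        rw [norm_pos_iff]
        rintro rfl
        simp at hy3
      have hle : ‖stretch V a y‖ ^ 2 ≤ (1 + 2 * ((a + a ^ 2 / 2) * θ)) * ‖y‖ ^ 2 := by
        have := mul_le_mul_of_nonneg_left hy3.le (show 0 ≤ 2 * a + a ^ 2 by positivity)
        linarith
      rw [ha] at hle ⊢
      refine ⟨fun h => ?_, ?_⟩
      · have h := h.2
        rw [map_stretch V L hV, norm_smul, Real.norm_of_nonneg (by linarith)] at h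
        exact lt_irrefl _ (h.trans_lt (distortion_lt hε hε3 hθ0 hθ1 hy0 (norm_nonneg _) hle hy2))
      · have h1 := Real.add_one_le_exp (2 * ((8 * ε + (8 * ε) ^ 2 / 2) * θ))
        refine (sq_le_sq₀ (norm_nonneg _) (Real.exp_pos _).le).1 (hle.trans ?_)
        rw [← Real.exp_nat_mul]
        have h4 : ‖y‖ ^ 2 ≤ 1 := pow_le_one₀ hy0.le hy1
        push_cast
        refine le_trans ?_ h1
        rw [add_comm]
        exact mul_le_of_le_one_right (by positivity) h4
  rw [← Real.exp_nat_mul] at key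
  have hlog : Real.exp ((a - a ^ 2) * r) ≤ (1 + a) ^ r := by
    rw [← Real.exp_log (show 0 < 1 + a by linarith), ← Real.exp_nat_mul, mul_comm (r : ℝ)]
    apply Real.exp_le_exp.2
    apply mul_le_mul_of_nonneg_right _ (by positivity)
    refine le_trans ?_ (Real.one_sub_inv_le_log_of_pos (show 0 < 1 + a by linarith))
    have : (1 + a)⁻¹ ≤ 1 - (a - a ^ 2) := by
      rw [inv_le_iff_one_le_mul₀ (by linarith)]
      nlinarith [pow_pos ha0 3]
    linarith
  have h1 : Real.exp ((a - a ^ 2) * r) * (17 / 30 * volume.real B) ≤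
      Real.exp (n * ((a + a ^ 2 / 2) * θ)) * (p * volume.real B) :=
    calc _ ≤ (1 + a) ^ r * volume.real G := by gcongr
      _ ≤ _ := key
      _ ≤ _ := by gcongr
  have h2 : Real.exp ((a - a ^ 2) * r) * (17 / 30) ≤
      Real.exp (n * ((a + a ^ 2 / 2) * θ)) * p :=
    le_of_mul_le_mul_right (by linarith) hB0
  have h3 : 17 / 30 * Real.exp ((a - a ^ 2) * r - n * ((a + a ^ 2 / 2) * θ)) ≤ p := by
    rw [Real.exp_sub, mul_div_assoc', div_le_iff₀ (Real.exp_pos _)]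
    linarith
  refine le_trans ?_ h3
  gcongr
  have e : n * ((a + a ^ 2 / 2) * θ) = (a + a ^ 2 / 2) * (r + 10 * s) := by
    rw [← hθn]; ring
  rw [e, mul_pow, hss, ha]
  have e1 : ε ^ 2 * r ≤ ε ^ 2 * m := mul_le_mul_of_nonneg_left hrm (sq_nonneg ε)
  have e2 : ε * (ε * s) ≤ 1 / 3 * (ε * s) :=
    mul_le_mul_of_nonneg_right hε3.le (by positivity)
  have e3 : 0 ≤ ε * s := by positivity
  nlinarith

end Concentration

theorem l2norm_eq_norm {k : ℕ} (v : EuclideanSpace ℝ (Fin k)) : l2norm v.ofLp = ‖v‖ := by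
  simp [l2norm, EuclideanSpace.norm_eq]

theorem measurable_l2norm {k : ℕ} : Measurable (l2norm : (Fin k → ℝ) → ℝ) := by
  unfold l2norm
  fun_prop

theorem measurable_mulVec {m n : ℕ} :
    Measurable fun q : Matrix (Fin m) (Fin n) ℝ × (Fin n → ℝ) => q.1.mulVec q.2 := by
  refine measurable_pi_lambda _ fun i => ?_
  simp only [Matrix.mulVec, dotProduct]
  refine Finset.measurable_sum _ fun j _ => Measurable.mul ?_ ?_
  · have h1 : Measurable fun Φ : Matrix (Fin m) (Fin n) ℝ => Φ i j :=
      (measurable_pi_apply j).comp (measurable_pi_apply (X := fun _ => Fin n → ℝ) i)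
    exact h1.comp measurable_fst
  · exact (measurable_pi_apply j).comp measurable_snd

theorem measurableSet_l2norm_mulVec_mem {m n : ℕ} (ε : ℝ) :
    MeasurableSet {q : Matrix (Fin m) (Fin n) ℝ × (Fin n → ℝ) |
      (1 - ε) * l2norm q.2 ≤ l2norm (q.1.mulVec q.2) ∧
        l2norm (q.1.mulVec q.2) ≤ (1 + ε) * l2norm q.2} := by
  have h1 := measurable_l2norm.comp (measurable_mulVec (m := m) (n := n))
  have h2 : Measurable fun q : Matrix (Fin m) (Fin n) ℝ × (Fin n → ℝ) => l2norm q.2 :=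
    measurable_l2norm.comp measurable_snd
  exact (measurableSet_le (h2.const_mul _) h1).inter (measurableSet_le h1 (h2.const_mul _))

/-- For any distribution of a random vector, some matrix in an oblivious subspace embedding
preserves the norms of `d` independent copies with probability at least `1 - δ`. -/
theorem IsOSE.exists_matrix {m n d : ℕ} {ε δ : ℝ} {D : Measure (Matrix (Fin m) (Fin n) ℝ)}
    [IsProbabilityMeasure D] (h : IsOSE d ε δ D) (hdn : d ≤ n) {Ω : Type*} [MeasurableSpace Ω]
    (ν : Measure Ω) [IsProbabilityMeasure ν] {X : Ω → Fin n → ℝ} (hX : Measurable X) :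
    ∃ Φ : Matrix (Fin m) (Fin n) ℝ, ENNReal.ofReal (1 - δ) ≤
      ν {ω | (1 - ε) * l2norm (X ω) ≤ l2norm (Φ.mulVec (X ω)) ∧
        l2norm (Φ.mulVec (X ω)) ≤ (1 + ε) * l2norm (X ω)} ^ d := by
  set π : Measure (Fin d → Ω) := Measure.pi fun _ => ν
  set T : Set (Matrix (Fin m) (Fin n) ℝ × (Fin d → Ω)) :=
    {q | ∀ i, (1 - ε) * l2norm (X (q.2 i)) ≤ l2norm (q.1.mulVec (X (q.2 i))) ∧
        l2norm (q.1.mulVec (X (q.2 i))) ≤ (1 + ε) * l2norm (X (q.2 i))} with hT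
  have hTm : MeasurableSet T := by
    rw [hT, Set.ofPred_forall]
    refine MeasurableSet.iInter fun i => ?_
    have hf : Measurable fun q : Matrix (Fin m) (Fin n) ℝ × (Fin d → Ω) => (q.1, X (q.2 i)) :=
      measurable_fst.prodMk (hX.comp ((measurable_pi_apply i).comp measurable_snd))
    exact hf (measurableSet_l2norm_mulVec_mem ε)
  have hlow : ENNReal.ofReal (1 - δ) ≤ D.prod π T := by
    rw [Measure.prod_apply_symm hTm]
    have hω : ∀ ω : Fin d → Ω, ENNReal.ofReal (1 - δ) ≤ D ((fun Φ => (Φ, ω)) ⁻¹' T) := by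
      intro ω
      have hr := finrank_range_le_card (R := ℝ) fun i => X (ω i)
      rw [Fintype.card_fin] at hr
      obtain ⟨W, hW, hWd⟩ := exists_le_submodule_finrank_eq
        (Submodule.span ℝ (Set.range fun i => X (ω i))) hr (by simpa using hdn)
      refine (h W hWd).trans (measure_mono fun Φ hΦ i => ?_)
      exact hΦ _ (hW (Submodule.subset_span ⟨i, rfl⟩))
    calc ENNReal.ofReal (1 - δ) = ∫⁻ _, ENNReal.ofReal (1 - δ) ∂π := by simp
      _ ≤ _ := lintegral_mono hω
  rw [Measure.prod_apply hTm] at hlow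
  obtain ⟨Φ, hΦ⟩ := exists_lintegral_le (μ := D) (f := fun Φ => π (Prod.mk Φ ⁻¹' T)) (by
    rw [← Measure.prod_apply hTm]
    exact measure_ne_top _ _)
  refine ⟨Φ, (hlow.trans hΦ).trans (le_of_eq ?_)⟩
  have : Prod.mk Φ ⁻¹' T = Set.univ.pi fun _ : Fin d =>
      {ω | (1 - ε) * l2norm (X ω) ≤ l2norm (Φ.mulVec (X ω)) ∧
        l2norm (Φ.mulVec (X ω)) ≤ (1 + ε) * l2norm (X ω)} := by
    ext ω
    simp [hT]
  rw [this, Measure.pi_pi, Finset.prod_const, Finset.card_univ, Fintype.card_fin]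

theorem log_div_le_of_exp_le {d : ℕ} (hd : 0 < d) {δ p t : ℝ} (hδ : 0 < δ) (hδ3 : δ < 1 / 3)
    (hp0 : 0 ≤ p) (hp : p < 1 / 3) (hpd : 1 - δ ≤ (1 - p) ^ d) (ht : 0 ≤ t)
    (h : 17 / 30 * Real.exp (-(96 * t ^ 2 + 187 * t)) ≤ p) :
    Real.log (d / δ) ≤ 4000000 * t ^ 2 := by
  have hd0 : (0 : ℝ) < d := by exact_mod_cast hd
  have hdp : d * p ≤ 2 * δ := by
    have h1 : (1 - p) ^ d * (1 + d * p) ≤ 1 := by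
      calc (1 - p) ^ d * (1 + d * p) ≤ (1 - p) ^ d * (1 + p) ^ d := by
            refine mul_le_mul_of_nonneg_left ?_ (pow_nonneg (by linarith) _)
            exact one_add_mul_le_pow (by linarith) d
        _ = ((1 - p) * (1 + p)) ^ d := (mul_pow _ _ _).symm
        _ ≤ 1 := pow_le_one₀ (by nlinarith) (by nlinarith)
    have h2 : 0 ≤ d * p := by positivity
    have h3 : (1 - δ) * (1 + d * p) ≤ 1 :=
      (mul_le_mul_of_nonneg_right hpd (by linarith)).trans h1
    nlinarith
  have ht0 : 1 / 1000 ≤ t := by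
    by_contra! hlt
    have h1 := Real.add_one_le_exp (-(96 * t ^ 2 + 187 * t))
    nlinarith
  have hle : d / δ ≤ 2 * (30 / 17) * Real.exp (96 * t ^ 2 + 187 * t) := by
    rw [Real.exp_neg] at h
    have hE := Real.exp_pos (96 * t ^ 2 + 187 * t)
    have h1 : 17 / 30 ≤ p * Real.exp (96 * t ^ 2 + 187 * t) := by
      rw [← div_eq_mul_inv, div_le_iff₀ hE] at h
      exact h
    rw [div_le_iff₀ hδ]
    have h2 : d * (17 / 30) ≤ 2 * δ * Real.exp (96 * t ^ 2 + 187 * t) :=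
      calc d * (17 / 30) ≤ d * (p * Real.exp (96 * t ^ 2 + 187 * t)) := by gcongr
        _ = d * p * Real.exp (96 * t ^ 2 + 187 * t) := by ring
        _ ≤ _ := by gcongr
    linarith
  have hlog := Real.log_le_log (by positivity) hle
  rw [Real.log_mul (by norm_num) (Real.exp_pos _).ne', Real.log_exp] at hlog
  have h4 : Real.log (2 * (30 / 17)) ≤ 3 := by
    have := Real.log_le_sub_one_of_pos (show (0 : ℝ) < 2 * (30 / 17) by norm_num)
    linarith
  nlinarith

theorem finrank_ker_orthogonal_le {E F : Type*} [NormedAddCommGroup E] [InnerProductSpace ℝ E]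
    [FiniteDimensional ℝ E] [AddCommGroup F] [Module ℝ F] [FiniteDimensional ℝ F]
    (L : E →ₗ[ℝ] F) : Module.finrank ℝ (LinearMap.ker L)ᗮ ≤ Module.finrank ℝ F := by
  have h1 := (LinearMap.ker L).finrank_add_finrank_orthogonal
  have h2 := L.finrank_range_add_finrank_ker
  have h3 := Submodule.finrank_le (LinearMap.range L)
  omega

theorem stmt1 :
    ∃ c : ℝ, 0 < c ∧
      ∀ (n m d : ℕ) (ε δ : ℝ) (D : Measure (Matrix (Fin m) (Fin n) ℝ)),
        IsProbabilityMeasure D →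
        0 < d → d ≤ m → m ≤ n →
        ε ∈ Set.Ioo (0:ℝ) (1/3) → δ ∈ Set.Ioo (0:ℝ) (1/3) →
        IsOSE d ε δ D →
        c * min (n : ℝ) ((ε ^ 2)⁻¹ * Real.log ((d : ℝ) / δ)) ≤ (m : ℝ) := by
  refine ⟨1 / 4000000, by norm_num, ?_⟩
  rintro n m d ε δ D hD hd hdm hmn ⟨hε, hε3⟩ ⟨hδ, hδ3⟩ hose
  by_cases hn : n < 110 * m
  · have : (n : ℝ) ≤ 110 * m := by exact_mod_cast hn.le
    have := min_le_left (n : ℝ) ((ε ^ 2)⁻¹ * Real.log ((d : ℝ) / δ))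
    have : (0 : ℝ) ≤ m := by positivity
    linarith
  set B := Metric.closedBall (0 : EuclideanSpace ℝ (Fin n)) 1
  have hBfin : volume B ≠ ⊤ :=
    (isCompact_closedBall (0 : EuclideanSpace ℝ (Fin n)) 1).measure_lt_top.ne
  have hB0 : volume B ≠ 0 := (Metric.measure_closedBall_pos volume _ one_pos).ne'
  have hBpos : 0 < volume.real B := ENNReal.toReal_pos hB0 hBfin
  have hBm : MeasurableSet B := Metric.isClosed_closedBall.measurableSet
  have : IsProbabilityMeasure (cond volume B) := cond_isProbabilityMeasure_of_finite hB0 hBfin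
  have hX : Measurable fun x : EuclideanSpace ℝ (Fin n) => x.ofLp := by fun_prop
  obtain ⟨Φ, hΦ⟩ := hose.exists_matrix (hdm.trans hmn) (cond volume B) hX
  set L := Matrix.toEuclideanLin Φ
  have hS : {x : EuclideanSpace ℝ (Fin n) | (1 - ε) * l2norm x.ofLp ≤ l2norm (Φ.mulVec x.ofLp) ∧
        l2norm (Φ.mulVec x.ofLp) ≤ (1 + ε) * l2norm x.ofLp} =
      {x | (1 - ε) * ‖x‖ ≤ ‖L x‖ ∧ ‖L x‖ ≤ (1 + ε) * ‖x‖} := by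
    ext x
    simp only [Set.mem_ofPred_eq, ← l2norm_eq_norm]
    rfl
  rw [hS] at hΦ
  set S := {x : EuclideanSpace ℝ (Fin n) | (1 - ε) * ‖x‖ ≤ ‖L x‖ ∧ ‖L x‖ ≤ (1 + ε) * ‖x‖}
  have hSm : MeasurableSet S := by
    have hL : Continuous L := L.continuous_of_finiteDimensional
    exact (measurableSet_le (measurable_norm.const_mul _) hL.norm.measurable).inter
      (measurableSet_le hL.norm.measurable (measurable_norm.const_mul _))
  obtain ⟨p, hp⟩ : ∃ p, p = (cond volume B).real Sᶜ := ⟨_, rfl⟩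
  have hp0 : 0 ≤ p := hp ▸ measureReal_nonneg
  have hSp : (cond volume B).real S = 1 - p := by
    rw [hp, probReal_compl_eq_one_sub hSm]
    ring
  have hp1 : p ≤ 1 := hp ▸ measureReal_le_one
  have hpd : 1 - δ ≤ (1 - p) ^ d := by
    have := ENNReal.toReal_mono (ENNReal.pow_ne_top (measure_ne_top _ _)) hΦ
    rwa [ENNReal.toReal_pow, ← measureReal_def, hSp, ENNReal.toReal_ofReal (by linarith)] at this
  have hp3 : p < 1 / 3 := by
    have := pow_le_of_le_one (sub_nonneg.2 hp1) (by linarith) hd.ne'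
    linarith
  have hbad : volume.real (Sᶜ ∩ B) ≤ p * volume.real B := by
    rw [hp, measureReal_def (cond volume B), cond_apply hBm, ENNReal.toReal_mul,
      ENNReal.toReal_inv, ← measureReal_def, ← measureReal_def, Set.inter_comm, mul_right_comm,
      inv_mul_cancel₀ hBpos.ne', one_mul]
  have h1 := exp_le_of_volume_distorted_le L (hd.trans_le hdm)
    (by simpa using finrank_ker_orthogonal_le L) (by simpa using not_lt.1 hn) hε hε3 hp3 hbad
  have h2 := log_div_le_of_exp_le hd hδ hδ3 hp0 hp3 hpd (by positivity) h1
  rw [mul_pow, Real.sq_sqrt (by positivity)] at h2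
  have h3 : (ε ^ 2)⁻¹ * Real.log ((d : ℝ) / δ) ≤ 4000000 * m := by
    rw [inv_mul_le_iff₀ (by positivity)]
    linarith
  have := (min_le_right (n : ℝ) _).trans h3
  linarith
end

section
/- There exist absolute constants c > 0 and d₀ such that the following holds. Let d ≥ d₀, n ≥ 100d², ε ∈ (0, 1/3), and suppose D is an (ε, δ) oblivious subspace embedding over real m×n matrices for d-dimensional subspaces with δ ≤ 1/100, such that every matrix Π in the support of D has at most s non-zero entries in each column. If m ≤ ε² · d(d−1)/32, then s ≥ c/ε. -/
open MeasureTheory ProbabilityTheory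
open scoped BigOperators

/-- Every matrix in the (a.e.) support of `D` has at most `s` non-zero entries per column. -/
def ColSparse {m n : ℕ} (s : ℕ) (D : Measure (Matrix (Fin m) (Fin n) ℝ)) : Prop :=
  ∀ᵐ Φ ∂D, ∀ j : Fin n, (Finset.univ.filter fun i : Fin m => Φ i j ≠ 0).card ≤ s

open Finset in
lemma expect_fin_cons {Ω : Type*} [Fintype Ω] {k : ℕ} (F : (Fin (k + 1) → Ω) → ℝ) :
    𝔼 X, F X = 𝔼 x, 𝔼 X : Fin k → Ω, F (Fin.cons x X) := by
  rw [← Finset.expect_product' univ univ fun x X => F (Fin.cons x X), univ_product_univ]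
  exact (Fintype.expect_equiv (Fin.consEquiv fun _ => Ω) _ _ fun _ => rfl).symm

open Finset in
/-- First moment of a sum of i.i.d. samples. -/
lemma expect_sum_iid {Ω : Type*} [Fintype Ω] [Nonempty Ω] (f : Ω → ℝ) (k : ℕ) :
    𝔼 X : Fin k → Ω, ∑ a, f (X a) = k * 𝔼 x, f x := by
  induction k with
  | zero => simp
  | succ k ih =>
    rw [expect_fin_cons]
    simp only [Fin.sum_univ_succ, Fin.cons_zero, Fin.cons_succ, expect_add_distrib, ih,
      Fintype.expect_const]
    push_cast; ring

open Finset in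
/-- Second moment bound for a sum of i.i.d. samples. -/
lemma expect_sq_sum_iid_le {Ω : Type*} [Fintype Ω] [Nonempty Ω] (f : Ω → ℝ) (k : ℕ) :
    𝔼 X : Fin k → Ω, (∑ a, f (X a)) ^ 2 ≤ k * 𝔼 x, f x ^ 2 + k ^ 2 * (𝔼 x, f x) ^ 2 := by
  induction k with
  | zero => simp
  | succ k ih =>
    rw [expect_fin_cons]
    simp only [Fin.sum_univ_succ, Fin.cons_zero, Fin.cons_succ, add_sq, expect_add_distrib,
      Fintype.expect_const, ← mul_expect, expect_sum_iid]
    simp only [← expect_mul, ← mul_expect]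
    push_cast
    nlinarith [sq_nonneg (𝔼 x, f x)]

open Finset in
/-- Second moment bound for the bipartite sum of a kernel over two independent samples. -/
lemma expect_sq_bipartite_le {Ω : Type*} [Fintype Ω] [Nonempty Ω] (g : Ω → Ω → ℝ) (k : ℕ)
    {v B : ℝ} (hv : 𝔼 x, 𝔼 y, g x y ^ 2 ≤ v) (hx : ∀ x, (𝔼 y, g x y) ^ 2 ≤ B)
    (hy : ∀ y, (𝔼 x, g x y) ^ 2 ≤ B) :
    𝔼 X : Fin k → Ω, 𝔼 Y : Fin k → Ω, (∑ a, ∑ b, g (X a) (Y b)) ^ 2 ≤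
      k ^ 2 * v + 2 * k ^ 3 * B + k ^ 4 * (𝔼 x, 𝔼 y, g x y) ^ 2 := by
  have h1 : ∀ X : Fin k → Ω, 𝔼 Y : Fin k → Ω, (∑ a, ∑ b, g (X a) (Y b)) ^ 2 ≤
      k * 𝔼 y, (∑ a, g (X a) y) ^ 2 + k ^ 2 * (∑ a, 𝔼 y, g (X a) y) ^ 2 := by
    intro X
    have := expect_sq_sum_iid_le (fun y => ∑ a, g (X a) y) k
    rw [expect_sum_comm] at this
    refine le_trans (le_of_eq ?_) this
    exact expect_congr rfl fun Y _ => by rw [sum_comm]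
  have h2 : 𝔼 X : Fin k → Ω, 𝔼 y, (∑ a, g (X a) y) ^ 2 ≤ k * v + k ^ 2 * B := by
    rw [expect_comm]
    calc 𝔼 y, 𝔼 X : Fin k → Ω, (∑ a, g (X a) y) ^ 2
        ≤ 𝔼 y, (k * 𝔼 x, g x y ^ 2 + k ^ 2 * B) := by
          refine expect_le_expect fun y _ => (expect_sq_sum_iid_le (fun x => g x y) k).trans ?_
          gcongr
          exact hy y
      _ = k * 𝔼 x, 𝔼 y, g x y ^ 2 + k ^ 2 * B := by
          rw [expect_add_distrib, ← mul_expect, expect_comm, Fintype.expect_const]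
      _ ≤ _ := by gcongr
  have h3 : 𝔼 X : Fin k → Ω, (∑ a, 𝔼 y, g (X a) y) ^ 2 ≤
      k * B + k ^ 2 * (𝔼 x, 𝔼 y, g x y) ^ 2 := by
    refine (expect_sq_sum_iid_le (fun x => 𝔼 y, g x y) k).trans ?_
    gcongr
    exact expect_le univ_nonempty fun x _ => hx x
  calc _ ≤ 𝔼 X : Fin k → Ω,
        (k * 𝔼 y, (∑ a, g (X a) y) ^ 2 + k ^ 2 * (∑ a, 𝔼 y, g (X a) y) ^ 2) :=
        expect_le_expect fun X _ => h1 X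
    _ = k * 𝔼 X : Fin k → Ω, 𝔼 y, (∑ a, g (X a) y) ^ 2 +
        k ^ 2 * 𝔼 X : Fin k → Ω, (∑ a, 𝔼 y, g (X a) y) ^ 2 := by
        rw [expect_add_distrib, ← mul_expect, ← mul_expect]
    _ ≤ k * (k * v + k ^ 2 * B) + k ^ 2 * (k * B + k ^ 2 * (𝔼 x, 𝔼 y, g x y) ^ 2) := by gcongr
    _ = _ := by ring

open Finset in
/-- Chebyshev's inequality: if the bipartite sum of a kernel with positive mean is nonpositive on
an event of probability at least `q`, then its variance bound controls its mean. -/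
lemma mul_sq_expect_le_of_bipartite_nonpos {Ω : Type*} [Fintype Ω] [Nonempty Ω]
    (g : Ω → Ω → ℝ) {k : ℕ} (hk : 0 < k) {v B q : ℝ}
    (hv : 𝔼 x, 𝔼 y, g x y ^ 2 ≤ v) (hx : ∀ x, (𝔼 y, g x y) ^ 2 ≤ B)
    (hy : ∀ y, (𝔼 x, g x y) ^ 2 ≤ B) (hμ : 0 ≤ 𝔼 x, 𝔼 y, g x y)
    (S : Set ((Fin k → Ω) × (Fin k → Ω)))
    (hq : q ≤ 𝔼 X : Fin k → Ω, 𝔼 Y : Fin k → Ω, S.indicator 1 (X, Y))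
    (hS : ∀ X Y, (X, Y) ∈ S → ∑ a, ∑ b, g (X a) (Y b) ≤ 0) :
    q * (k * 𝔼 x, 𝔼 y, g x y) ^ 2 ≤ v + 2 * k * B := by
  have hmom := expect_sq_bipartite_le g k hv hx hy
  set μ := 𝔼 x, 𝔼 y, g x y with hμ_def
  have hmean : 𝔼 X : Fin k → Ω, 𝔼 Y : Fin k → Ω, ∑ a, ∑ b, g (X a) (Y b) = k ^ 2 * μ := by
    have : ∀ X : Fin k → Ω, 𝔼 Y : Fin k → Ω, ∑ a, ∑ b, g (X a) (Y b) =
        k * ∑ a, 𝔼 y, g (X a) y := by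
      intro X
      rw [expect_sum_comm, mul_sum]
      exact sum_congr rfl fun a _ => expect_sum_iid (g (X a)) k
    simp only [this, ← mul_expect]
    rw [expect_sum_iid fun x => 𝔼 y, g x y]
    ring
  have hvar : 𝔼 X : Fin k → Ω, 𝔼 Y : Fin k → Ω, (∑ a, ∑ b, g (X a) (Y b) - k ^ 2 * μ) ^ 2 ≤
      k ^ 2 * v + 2 * k ^ 3 * B := by
    simp only [sub_sq, expect_add_distrib, expect_sub_distrib, Fintype.expect_const]
    have : 𝔼 X : Fin k → Ω, 𝔼 Y : Fin k → Ω, 2 * (∑ a, ∑ b, g (X a) (Y b)) * (k ^ 2 * μ) =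
        2 * (k ^ 2 * μ) * (k ^ 2 * μ) := by
      simp only [← expect_mul, ← mul_expect, hmean]
    rw [this]
    nlinarith
  have hlow : 𝔼 X : Fin k → Ω, 𝔼 Y : Fin k → Ω, S.indicator 1 (X, Y) * (k ^ 2 * μ) ^ 2 ≤
      𝔼 X : Fin k → Ω, 𝔼 Y : Fin k → Ω, (∑ a, ∑ b, g (X a) (Y b) - k ^ 2 * μ) ^ 2 := by
    refine expect_le_expect fun X _ => expect_le_expect fun Y _ => ?_
    by_cases h : (X, Y) ∈ S
    · have h0 := hS X Y h
      have : 0 ≤ (k : ℝ) ^ 2 * μ := by positivity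
      simp only [Set.indicator_of_mem h, Pi.one_apply, one_mul]
      nlinarith
    · simp only [Set.indicator_of_notMem h, zero_mul]
      positivity
  simp only [← expect_mul] at hlow
  have hk' : (0 : ℝ) < k ^ 2 := by positivity
  have : k ^ 2 * (q * (k * μ) ^ 2) ≤ k ^ 2 * (v + 2 * k * B) := by
    calc k ^ 2 * (q * (k * μ) ^ 2) = q * (k ^ 2 * μ) ^ 2 := by ring
      _ ≤ _ := mul_le_mul_of_nonneg_right hq (sq_nonneg _)
      _ ≤ _ := hlow.trans hvar
      _ = _ := by ring
  exact le_of_mul_le_mul_left this hk'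

section Kernel

variable {Ω κ : Type*} [Fintype Ω] [DecidableEq Ω] [DecidableEq κ]

/-- The kernel equal to `w x y` for distinct points `x, y` of `G` with the same colour,
reweighted by the inverse density of the colour class, and zero elsewhere. -/
noncomputable def colorKernel (G : Finset Ω) (cl : Ω → κ) (w : Ω → Ω → ℝ) (x y : Ω) : ℝ :=
  if x ∈ G ∧ y ∈ G ∧ cl y = cl x ∧ x ≠ y then
    Fintype.card Ω / (G.filter fun z => cl z = cl x).card * w x y
  else 0

variable {G : Finset Ω} {cl : Ω → κ} {w : Ω → Ω → ℝ} {B : ℝ}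

lemma colorKernel_symm (hw : ∀ x y, w x y = w y x) (x y : Ω) :
    colorKernel G cl w x y = colorKernel G cl w y x := by
  unfold colorKernel
  by_cases h : x ∈ G ∧ y ∈ G ∧ cl y = cl x ∧ x ≠ y
  · have h' : y ∈ G ∧ x ∈ G ∧ cl x = cl y ∧ y ≠ x := ⟨h.2.1, h.1, h.2.2.1.symm, h.2.2.2.symm⟩
    rw [if_pos h, if_pos h', h.2.2.1, hw]
  · have h' : ¬(y ∈ G ∧ x ∈ G ∧ cl x = cl y ∧ y ≠ x) :=
      fun h' => h ⟨h'.2.1, h'.1, h'.2.2.1.symm, h'.2.2.2.symm⟩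
    rw [if_neg h, if_neg h']

lemma abs_colorKernel_le (hB : 0 ≤ B) (hw : ∀ x ∈ G, ∀ y ∈ G, |w x y| ≤ B) (x y : Ω) :
    |colorKernel G cl w x y| ≤
      if x ∈ G then
        if y ∈ G.filter fun z => cl z = cl x then
          Fintype.card Ω / (G.filter fun z => cl z = cl x).card * B
        else 0
      else 0 := by
  unfold colorKernel
  split_ifs with h1 h2 h3 h2 h3
  · rw [abs_mul, abs_of_nonneg (by positivity)]
    gcongr
    exact hw x h1.1 y h1.2.1
  · exact absurd (Finset.mem_filter.2 ⟨h1.2.1, h1.2.2.1⟩) h3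
  · exact absurd h1.1 h2
  · simpa using by positivity
  · simp
  · simp

open Finset in
lemma abs_expect_colorKernel_le (hB : 0 ≤ B) (hw : ∀ x ∈ G, ∀ y ∈ G, |w x y| ≤ B) (x : Ω) :
    |𝔼 y, colorKernel G cl w x y| ≤ B := by
  refine (abs_expect_le _ _).trans
    ((expect_le_expect fun y _ => abs_colorKernel_le hB hw x y).trans ?_)
  by_cases hx : x ∈ G
  · have hN : (0 : ℝ) < (G.filter fun z => cl z = cl x).card := 
      Nat.cast_pos.2 (card_pos.2 ⟨x, mem_filter.2 ⟨hx, rfl⟩⟩)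
    have hn : (0 : ℝ) < Fintype.card Ω := by exact_mod_cast Fintype.card_pos_iff.2 ⟨x⟩
    simp only [if_pos hx]
    rw [Fintype.expect_eq_sum_div_card, sum_ite_mem, univ_inter, sum_const, nsmul_eq_mul]
    refine le_of_eq ?_
    field_simp
  · simpa [hx] using hB

open Finset in
lemma expect_colorKernel_sq_le [Fintype κ] (hB : 0 ≤ B)
    (hw : ∀ x ∈ G, ∀ y ∈ G, |w x y| ≤ B) :
    𝔼 x, 𝔼 y, colorKernel G cl w x y ^ 2 ≤ B ^ 2 * Fintype.card κ := by
  rcases isEmpty_or_nonempty Ω with hΩ | hΩ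
  · simpa using by positivity
  have hn : (0 : ℝ) < Fintype.card Ω := by exact_mod_cast Fintype.card_pos
  have hrow : ∀ x, 𝔼 y, colorKernel G cl w x y ^ 2 ≤
      if x ∈ G then Fintype.card Ω / (G.filter fun z => cl z = cl x).card * B ^ 2 else 0 := by
    intro x
    by_cases hx : x ∈ G
    · have hN : (0 : ℝ) < (G.filter fun z => cl z = cl x).card := 
        Nat.cast_pos.2 (card_pos.2 ⟨x, mem_filter.2 ⟨hx, rfl⟩⟩)
      rw [if_pos hx]
      calc 𝔼 y, colorKernel G cl w x y ^ 2
          ≤ 𝔼 y, if y ∈ G.filter fun z => cl z = cl x then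
              (Fintype.card Ω / (G.filter fun z => cl z = cl x).card * B) ^ 2 else 0 := by
            refine expect_le_expect fun y _ => ?_
            have h := abs_colorKernel_le (cl := cl) hB hw x y
            rw [if_pos hx] at h
            rw [← sq_abs]
            refine (pow_le_pow_left₀ (abs_nonneg _) h 2).trans ?_
            split_ifs <;> simp
        _ = _ := by
            rw [Fintype.expect_eq_sum_div_card, sum_ite_mem, univ_inter, sum_const, nsmul_eq_mul]
            field_simp
    · simp [colorKernel, hx]
  calc 𝔼 x, 𝔼 y, colorKernel G cl w x y ^ 2
      ≤ 𝔼 x, if x ∈ G then Fintype.card Ω / (G.filter fun z => cl z = cl x).card * B ^ 2 else 0 :=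
        expect_le_expect fun x _ => hrow x
    _ = B ^ 2 * ∑ x ∈ G, ((G.filter fun z => cl z = cl x).card : ℝ)⁻¹ := by
        rw [Fintype.expect_eq_sum_div_card, sum_ite_mem, univ_inter, sum_div, mul_sum]
        refine sum_congr rfl fun x _ => ?_
        field_simp
    _ = B ^ 2 * ∑ c, ∑ x ∈ G with cl x = c, ((G.filter fun z => cl z = c).card : ℝ)⁻¹ := by
        rw [← sum_fiberwise G cl]
        congr 1
        refine sum_congr rfl fun c _ => sum_congr rfl fun x hx => ?_
        rw [(mem_filter.1 hx).2]
    _ ≤ B ^ 2 * ∑ _c : κ, 1 := by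
        gcongr with c
        rw [sum_const, nsmul_eq_mul]
        exact mul_inv_le_one
    _ = _ := by simp

open Finset in
lemma le_expect_colorKernel [Fintype κ] {α β : ℝ} (hβ : 0 ≤ β)
    (hsum : ∀ c, α * ((G.filter fun z => cl z = c).card : ℝ) ^ 2 -
        β * (G.filter fun z => cl z = c).card ≤
      ∑ x ∈ G with cl x = c, ∑ y ∈ G with cl y = c, if x ≠ y then w x y else 0) :
    (α * G.card - β * Fintype.card κ) / Fintype.card Ω ≤
      𝔼 x, 𝔼 y, colorKernel G cl w x y := by
  rcases isEmpty_or_nonempty Ω with hΩ | hΩ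
  · simp
  have hn : (0 : ℝ) < Fintype.card Ω := by exact_mod_cast Fintype.card_pos
  simp only [Fintype.expect_eq_sum_div_card, ← sum_div]
  rw [div_le_div_iff_of_pos_right hn, le_div_iff₀ hn]
  have hrow : ∀ x, ∑ y, colorKernel G cl w x y = if x ∈ G then
      Fintype.card Ω / ((G.filter fun z => cl z = cl x).card : ℝ) *
        ∑ y ∈ G with cl y = cl x, (if x ≠ y then w x y else 0) else 0 := by
    intro x
    by_cases hx : x ∈ G
    · rw [if_pos hx, mul_sum]
      refine (sum_subset (subset_univ (G.filter fun z => cl z = cl x)) fun y _ hy => ?_).symm.trans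
        (sum_congr rfl fun y hy => ?_)
      · rw [mem_filter] at hy
        exact if_neg fun h => hy ⟨h.2.1, h.2.2.1⟩
      · rw [mem_filter] at hy
        simp [colorKernel, hx, hy.1, hy.2]
    · simp [colorKernel, hx]
  rw [sum_congr rfl fun x _ => hrow x, sum_ite_mem, univ_inter, ← sum_fiberwise G cl]
  calc (α * G.card - β * Fintype.card κ) * Fintype.card Ω
      = ∑ c, (α * (G.filter fun z => cl z = c).card - β) * Fintype.card Ω := by
        rw [← sum_mul, sum_sub_distrib, ← mul_sum, ← Nat.cast_sum,
          ← card_eq_sum_card_fiberwise fun x _ => mem_coe.2 (mem_univ (cl x))]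
        simp [mul_comm]
    _ ≤ ∑ c, (Fintype.card Ω / ((G.filter fun z => cl z = c).card : ℝ)) *
          ∑ x ∈ G with cl x = c, ∑ y ∈ G with cl y = c, if x ≠ y then w x y else 0 := by
        refine sum_le_sum fun c _ => ?_
        rcases (G.filter fun z => cl z = c).eq_empty_or_nonempty with h | h
        · simp only [h]
          simpa using by positivity
        · have hN : (0 : ℝ) < (G.filter fun z => cl z = c).card := by
            exact_mod_cast card_pos.2 h
          calc _ = (Fintype.card Ω / ((G.filter fun z => cl z = c).card : ℝ)) *
                (α * ((G.filter fun z => cl z = c).card : ℝ) ^ 2 -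
                  β * (G.filter fun z => cl z = c).card) := by field_simp
            _ ≤ _ := by
              gcongr
              exact hsum c
    _ = _ := by
        refine sum_congr rfl fun c _ => ?_
        rw [mul_sum]
        refine sum_congr rfl fun x hx => ?_
        rw [(mem_filter.1 hx).2]

end Kernel

section Columns

variable {m n : ℕ}

/-- The columns of `Φ` whose Euclidean norm lies in `[1 - ε, 1 + ε]`. -/
noncomputable def goodColumns (Φ : Matrix (Fin m) (Fin n) ℝ) (ε : ℝ) : Finset (Fin n) :=
  Finset.univ.filter fun j => (1 - ε) ^ 2 ≤ ∑ i, Φ i j ^ 2 ∧ ∑ i, Φ i j ^ 2 ≤ (1 + ε) ^ 2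

lemma mem_goodColumns {Φ : Matrix (Fin m) (Fin n) ℝ} {ε : ℝ} {j : Fin n} :
    j ∈ goodColumns Φ ε ↔ (1 - ε) ^ 2 ≤ ∑ i, Φ i j ^ 2 ∧ ∑ i, Φ i j ^ 2 ≤ (1 + ε) ^ 2 := by
  simp [goodColumns]

/-- The matrices whose columns sampled by `X` and `Y` have norm close to one, and such that
distinct columns from the two samples have inner product at most `4 * ε`. -/
def nearOrthoSet (ε : ℝ) {k : ℕ} (X Y : Fin k → Fin n) : Set (Matrix (Fin m) (Fin n) ℝ) :=
  {Φ | ((∀ a, (1 - ε) ^ 2 ≤ ∑ i, Φ i (X a) ^ 2 ∧ ∑ i, Φ i (X a) ^ 2 ≤ (1 + ε) ^ 2) ∧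
      ∀ b, (1 - ε) ^ 2 ≤ ∑ i, Φ i (Y b) ^ 2 ∧ ∑ i, Φ i (Y b) ^ 2 ≤ (1 + ε) ^ 2) ∧
    ∀ a b, X a ≠ Y b → ∑ i, Φ i (X a) * Φ i (Y b) ≤ 4 * ε}

lemma measurableSet_nearOrthoSet (ε : ℝ) {k : ℕ} (X Y : Fin k → Fin n) :
    MeasurableSet (nearOrthoSet ε X Y : Set (Matrix (Fin m) (Fin n) ℝ)) := by
  have hentry : ∀ i j, Measurable fun Φ : Matrix (Fin m) (Fin n) ℝ => Φ i j :=
    fun i j => (measurable_pi_apply j).comp (measurable_pi_apply i)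
  have hsq : ∀ j, Measurable fun Φ : Matrix (Fin m) (Fin n) ℝ => ∑ i, Φ i j ^ 2 :=
    fun j => Finset.measurable_sum _ fun i _ => (hentry i j).pow_const 2
  have hip : ∀ j l, Measurable fun Φ : Matrix (Fin m) (Fin n) ℝ => ∑ i, Φ i j * Φ i l :=
    fun j l => Finset.measurable_sum _ fun i _ => (hentry i j).mul (hentry i l)
  have hgood : ∀ Z : Fin k → Fin n, MeasurableSet {Φ : Matrix (Fin m) (Fin n) ℝ |
      ∀ a, (1 - ε) ^ 2 ≤ ∑ i, Φ i (Z a) ^ 2 ∧ ∑ i, Φ i (Z a) ^ 2 ≤ (1 + ε) ^ 2} := by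
    intro Z
    simp only [Set.ofPred_forall]
    exact MeasurableSet.iInter fun a => (measurableSet_le measurable_const (hsq _)).inter
      (measurableSet_le (hsq _) measurable_const)
  have hcross : MeasurableSet {Φ : Matrix (Fin m) (Fin n) ℝ |
      ∀ a b, X a ≠ Y b → ∑ i, Φ i (X a) * Φ i (Y b) ≤ 4 * ε} := by
    simp only [Set.ofPred_forall]
    exact MeasurableSet.iInter fun a => MeasurableSet.iInter fun b => MeasurableSet.iInter fun _ =>
      measurableSet_le (hip _ _) measurable_const
  exact ((hgood X).inter (hgood Y)).inter hcross

open Finset in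
lemma abs_sum_mul_le {ι : Type*} [Fintype ι] (u v : ι → ℝ) {C : ℝ} (hu : ∑ i, u i ^ 2 ≤ C)
    (hv : ∑ i, v i ^ 2 ≤ C) : |∑ i, u i * v i| ≤ C := by
  have h1 : 0 ≤ ∑ i, (u i + v i) ^ 2 := sum_nonneg fun i _ => sq_nonneg _
  have h2 : 0 ≤ ∑ i, (u i - v i) ^ 2 := sum_nonneg fun i _ => sq_nonneg _
  simp only [add_sq, sub_sq, sum_add_distrib, sum_sub_distrib, mul_assoc, ← mul_sum] at h1 h2
  rw [abs_le]
  constructor <;> linarith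

open Finset in
/-- If the columns in `C` all have large entries of the same sign in row `i`, then their pairwise
inner products are large on average. -/
lemma le_sum_offDiag_inner (Φ : Matrix (Fin m) (Fin n) ℝ) (C : Finset (Fin n)) (i : Fin m)
    {τ θ β : ℝ} (hθ : 0 ≤ θ) (hτ : ∀ x ∈ C, ∀ y ∈ C, τ ≤ Φ i x * Φ i y)
    (hβ : ∀ x ∈ C, ∑ l, Φ l x ^ 2 ≤ β) :
    (τ - θ) * (C.card : ℝ) ^ 2 - β * C.card ≤
      ∑ x ∈ C, ∑ y ∈ C, if x ≠ y then (∑ l, Φ l x * Φ l y) - θ else 0 := by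
  have hrow : ∀ x ∈ C, (∑ y ∈ C, ∑ l, Φ l x * Φ l y) - θ * C.card - β ≤
      ∑ y ∈ C, if x ≠ y then (∑ l, Φ l x * Φ l y) - θ else 0 := by
    intro x hx
    have : ∑ y ∈ C, (if x ≠ y then (∑ l, Φ l x * Φ l y) - θ else 0) =
        ∑ y ∈ C, (((∑ l, Φ l x * Φ l y) - θ) -
          if x = y then (∑ l, Φ l x * Φ l y) - θ else 0) :=
      sum_congr rfl fun y _ => by by_cases h : x = y <;> simp [h]
    rw [this, sum_sub_distrib, sum_sub_distrib, sum_ite_eq, if_pos hx, sum_const, nsmul_eq_mul]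
    have := hβ x hx
    simp only [sq] at this
    linarith
  have hall : τ * (C.card : ℝ) ^ 2 ≤ ∑ x ∈ C, ∑ y ∈ C, ∑ l, Φ l x * Φ l y := by
    calc τ * (C.card : ℝ) ^ 2 = ∑ x ∈ C, ∑ y ∈ C, τ := by simp; ring
      _ ≤ ∑ x ∈ C, ∑ y ∈ C, Φ i x * Φ i y :=
        sum_le_sum fun x hx => sum_le_sum fun y hy => hτ x hx y hy
      _ = (∑ x ∈ C, Φ i x) ^ 2 := by rw [sq, sum_mul_sum]
      _ ≤ ∑ l, (∑ x ∈ C, Φ l x) ^ 2 :=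
        single_le_sum (f := fun l => (∑ x ∈ C, Φ l x) ^ 2) (fun l _ => sq_nonneg _) (mem_univ i)
      _ = ∑ l, ∑ x ∈ C, ∑ y ∈ C, Φ l x * Φ l y := by simp only [sq, sum_mul_sum]
      _ = _ := by
        rw [sum_comm]
        exact sum_congr rfl fun x _ => sum_comm
  calc (τ - θ) * (C.card : ℝ) ^ 2 - β * C.card
      ≤ (∑ x ∈ C, ∑ y ∈ C, ∑ l, Φ l x * Φ l y) - (θ * C.card + β) * C.card := by nlinarith
    _ = ∑ x ∈ C, ((∑ y ∈ C, ∑ l, Φ l x * Φ l y) - θ * C.card - β) := by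
        simp only [sum_sub_distrib, sum_const, nsmul_eq_mul]
        ring
    _ ≤ _ := sum_le_sum hrow

open Finset in
/-- A sparse column of large norm has a large entry. -/
lemma exists_sq_entry_ge (Φ : Matrix (Fin m) (Fin n) ℝ) (j : Fin n) {s : ℕ} {τ : ℝ}
    (hs : (univ.filter fun i => Φ i j ≠ 0).card ≤ s) (hτ : 0 ≤ τ)
    (hnorm : τ * s < ∑ i, Φ i j ^ 2) : ∃ i, τ ≤ Φ i j ^ 2 := by
  by_contra! h
  refine absurd hnorm (not_lt.2 ?_)
  calc ∑ i, Φ i j ^ 2 = ∑ i with Φ i j ≠ 0, Φ i j ^ 2 := by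
        refine (sum_filter_of_ne (p := fun i => Φ i j ≠ 0) fun i _ hi h0 => hi ?_).symm
        simp [h0]
    _ ≤ ∑ i with Φ i j ≠ 0, τ := sum_le_sum fun i _ => (h i).le
    _ = τ * (univ.filter fun i => Φ i j ≠ 0).card := by simp [mul_comm]
    _ ≤ τ * s := by gcongr

/-- Two reals with large squares and the same sign have a large product. -/
lemma le_mul_of_le_sq_of_sign_eq {a b τ : ℝ} (hτ : 0 ≤ τ) (ha : τ ≤ a ^ 2) (hb : τ ≤ b ^ 2)
    (h : 0 ≤ a ↔ 0 ≤ b) : τ ≤ a * b := by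
  have hab : 0 ≤ a * b := by
    by_cases h0 : 0 ≤ a
    · exact mul_nonneg h0 (h.1 h0)
    · exact mul_nonneg_of_nonpos_of_nonpos (not_le.1 h0).le
        (not_le.1 fun hb => h0 (h.2 hb)).le
  refine le_of_sq_le_sq ?_ hab
  rw [mul_pow, sq τ]
  exact mul_le_mul ha hb hτ (sq_nonneg a)

open Finset in
/-- A sparse matrix with few rows cannot have nearly orthonormal columns for most samples. -/
lemma not_le_expect_nearOrtho (Φ : Matrix (Fin m) (Fin n) ℝ) {ε : ℝ} {s k : ℕ}
    (hε : ε ∈ Set.Ioo (0 : ℝ) (1 / 3))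
    (hs : ∀ j, (univ.filter fun i => Φ i j ≠ 0).card ≤ s) (hsε : ε * s < 1 / 72)
    (hk : 0 < k) (hkm : 2 * k ≤ m) (hm : (m : ℝ) ≤ ε ^ 2 * k ^ 2 / 4)
    (hmn : (m : ℝ) ≤ ε ^ 2 * n / 3200)
    (hE : 99 / 100 ≤ 𝔼 X : Fin k → Fin n, 𝔼 Y : Fin k → Fin n,
      (nearOrthoSet ε X Y).indicator (1 : Matrix (Fin m) (Fin n) ℝ → ℝ) Φ) : False := by
  obtain ⟨hε0, hε3⟩ := hε
  have hm0 : 0 < m := by lia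
  have hmR : (0 : ℝ) < m := by exact_mod_cast hm0
  have hkR : (0 : ℝ) < k := by exact_mod_cast hk
  have hkmR : 2 * (k : ℝ) ≤ m := by exact_mod_cast hkm
  have hnR : (0 : ℝ) < n := by
    by_contra! h
    nlinarith [sq_nonneg ε]
  have hn : 0 < n := by exact_mod_cast hnR
  have : Nonempty (Fin m) := ⟨⟨0, hm0⟩⟩
  have : Nonempty (Fin n) := ⟨⟨0, hn⟩⟩
  set G := goodColumns Φ ε with hG
  have hbig : ∀ j ∈ G, ∃ i, 32 * ε ≤ Φ i j ^ 2 := by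
    intro j hj
    refine exists_sq_entry_ge Φ j (hs j) (by positivity) ?_
    have := (mem_goodColumns.1 hj).1
    nlinarith
  choose! row hrow using hbig
  have hGnorm : ∀ j ∈ G, ∑ i, Φ i j ^ 2 ≤ 16 / 9 := by
    intro j hj
    have := (mem_goodColumns.1 hj).2
    nlinarith
  set cl : Fin n → Fin m × Bool := fun j => (row j, decide (0 ≤ Φ (row j) j)) with hcl
  set w : Fin n → Fin n → ℝ := fun x y => (∑ i, Φ i x * Φ i y) - 4 * ε with hw_def
  have hwsymm : ∀ x y, w x y = w y x := fun x y => by simp only [hw_def, mul_comm]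
  have hw : ∀ x ∈ G, ∀ y ∈ G, |w x y| ≤ 4 := by
    intro x hx y hy
    have := abs_le.1 (abs_sum_mul_le (fun i => Φ i x) (fun i => Φ i y) (hGnorm x hx) (hGnorm y hy))
    rw [abs_le]
    constructor <;> simp only [hw_def] <;> linarith
  have hsum : ∀ c, (32 * ε - 4 * ε) * ((G.filter fun z => cl z = c).card : ℝ) ^ 2 -
      16 / 9 * (G.filter fun z => cl z = c).card ≤
      ∑ x ∈ G with cl x = c, ∑ y ∈ G with cl y = c, if x ≠ y then w x y else 0 := by
    rintro ⟨i, σ⟩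
    refine le_sum_offDiag_inner Φ _ i (by positivity) ?_ fun x hx => hGnorm x (mem_filter.1 hx).1
    intro x hx y hy
    simp only [mem_filter, hcl, Prod.mk.injEq] at hx hy
    obtain ⟨hxG, hxi, hxσ⟩ := hx
    obtain ⟨hyG, hyi, hyσ⟩ := hy
    have h1 := hrow x hxG
    have h2 := hrow y hyG
    rw [hxi] at h1 hxσ
    rw [hyi] at h2 hyσ
    exact le_mul_of_le_sq_of_sign_eq (by positivity) h1 h2
      (decide_eq_decide.1 (hxσ.trans hyσ.symm))
  have hGcard : 99 / 100 * (n : ℝ) ≤ G.card := by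
    have h1 : (𝔼 X : Fin k → Fin n, 𝔼 Y : Fin k → Fin n,
        (nearOrthoSet ε X Y).indicator (1 : Matrix (Fin m) (Fin n) ℝ → ℝ) Φ) * k ≤
        𝔼 X : Fin k → Fin n, ∑ a, if X a ∈ G then (1 : ℝ) else 0 := by
      rw [expect_mul]
      refine expect_le_expect fun X _ => ?_
      rw [expect_mul]
      refine expect_le univ_nonempty fun Y _ => ?_
      by_cases h : Φ ∈ nearOrthoSet ε X Y
      · simp only [Set.indicator_of_mem h, Pi.one_apply, one_mul]
        rw [sum_congr rfl fun a _ => if_pos (mem_goodColumns.2 (h.1.1 a))]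
        simp
      · rw [Set.indicator_of_notMem h, zero_mul]
        exact sum_nonneg fun a _ => by split_ifs <;> simp
    rw [expect_sum_iid fun x => if x ∈ G then (1 : ℝ) else 0, mul_comm] at h1
    have h2 := hE.trans (le_of_mul_le_mul_left h1 hkR)
    rwa [Fintype.expect_eq_sum_div_card, sum_boole, filter_mem_eq_inter, univ_inter,
      Fintype.card_fin, le_div_iff₀ hnR] at h2
  have hμ : 26 * ε ≤ 𝔼 x, 𝔼 y, colorKernel G cl w x y := by
    refine le_trans ?_ (le_expect_colorKernel (by norm_num) hsum)
    rw [Fintype.card_fin, le_div_iff₀ hnR]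
    simp only [Fintype.card_prod, Fintype.card_fin, Fintype.card_bool]
    push_cast
    nlinarith [mul_le_mul_of_nonneg_left hGcard hε0.le, mul_pos hε0 hnR,
      mul_lt_mul_of_pos_right hε3 (mul_pos hε0 hnR)]
  have hsqB : ∀ t : ℝ, |t| ≤ 4 → t ^ 2 ≤ 16 := fun t ht => by
    have := abs_le.1 ht
    nlinarith
  have key := mul_sq_expect_le_of_bipartite_nonpos (colorKernel G cl w) hk (q := 99 / 100)
    (expect_colorKernel_sq_le (cl := cl) (by norm_num : (0 : ℝ) ≤ 4) hw)
    (fun x => hsqB _ (abs_expect_colorKernel_le (by norm_num) hw x))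
    (fun y => hsqB _ (by
      simp only [colorKernel_symm hwsymm _ y]
      exact abs_expect_colorKernel_le (by norm_num) hw y))
    (by linarith) {p | Φ ∈ nearOrthoSet ε p.1 p.2} hE (by
      intro X Y h
      refine sum_nonpos fun a _ => sum_nonpos fun b _ => ?_
      unfold colorKernel
      split_ifs with hc
      · exact mul_nonpos_of_nonneg_of_nonpos (by positivity)
          (sub_nonpos.2 (h.2 a b hc.2.2.2))
      · exact le_rfl)
  simp only [Fintype.card_prod, Fintype.card_fin, Fintype.card_bool] at key
  push_cast at key
  have hlow : (k * (26 * ε)) ^ 2 ≤ (k * 𝔼 x, 𝔼 y, colorKernel G cl w x y) ^ 2 := by gcongr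
  nlinarith [mul_pos (pow_pos hkR 2) (pow_pos hε0 2)]

end Columns

section Embedding

variable {m n : ℕ}

lemma l2norm_sq {k : ℕ} (v : Fin k → ℝ) : l2norm v ^ 2 = ∑ i, v i ^ 2 :=
  Real.sq_sqrt (Finset.sum_nonneg fun _ _ => sq_nonneg _)

lemma l2norm_nonneg {k : ℕ} (v : Fin k → ℝ) : 0 ≤ l2norm v := Real.sqrt_nonneg _

lemma sq_embedding {Φ : Matrix (Fin m) (Fin n) ℝ} {ε : ℝ} (hε1 : ε < 1) {x : Fin n → ℝ}
    (h : (1 - ε) * l2norm x ≤ l2norm (Φ.mulVec x) ∧ l2norm (Φ.mulVec x) ≤ (1 + ε) * l2norm x) :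
    (1 - ε) ^ 2 * ∑ j, x j ^ 2 ≤ ∑ i, Φ.mulVec x i ^ 2 ∧
      ∑ i, Φ.mulVec x i ^ 2 ≤ (1 + ε) ^ 2 * ∑ j, x j ^ 2 := by
  simp only [← l2norm_sq, ← mul_pow]
  have h1 : 0 ≤ (1 - ε) * l2norm x := mul_nonneg (by linarith) (l2norm_nonneg x)
  exact ⟨pow_le_pow_left₀ h1 h.1 2, pow_le_pow_left₀ (l2norm_nonneg _) h.2 2⟩

open Finset in
/-- Any at most `d` coordinate vectors lie in a common `d`-dimensional subspace. -/
lemma exists_submodule_single_mem {d : ℕ} (hdn : d ≤ n) (F : Finset (Fin n)) (hF : F.card ≤ d) :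
    ∃ W : Submodule ℝ (Fin n → ℝ), Module.finrank ℝ W = d ∧
      ∀ j ∈ F, (Pi.single j 1 : Fin n → ℝ) ∈ W := by
  obtain ⟨T, hFT, -, hT⟩ := exists_subsuperset_card_eq (subset_univ F) hF (by simpa using hdn)
  have hli : LinearIndependent ℝ fun j : T => (Pi.single (j : Fin n) 1 : Fin n → ℝ) :=
    (Pi.linearIndependent_single_one (Fin n) ℝ).comp _ Subtype.val_injective
  refine ⟨Submodule.span ℝ (Set.range fun j : T => (Pi.single (j : Fin n) 1 : Fin n → ℝ)), ?_, ?_⟩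
  · rw [finrank_span_eq_card hli, Fintype.card_coe, hT]
  · exact fun j hj => Submodule.subset_span ⟨⟨j, hFT hj⟩, rfl⟩

/-- A matrix embedding a subspace containing the sampled coordinate vectors has nearly
orthonormal sampled columns. -/
lemma mem_nearOrthoSet_of_embedding {Φ : Matrix (Fin m) (Fin n) ℝ} {ε : ℝ}
    (hε1 : ε < 1) {k : ℕ} (X Y : Fin k → Fin n) (W : Submodule ℝ (Fin n → ℝ))
    (hX : ∀ a, (Pi.single (X a) 1 : Fin n → ℝ) ∈ W) (hY : ∀ b, (Pi.single (Y b) 1 : Fin n → ℝ) ∈ W)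
    (hΦ : ∀ x ∈ W, (1 - ε) * l2norm x ≤ l2norm (Φ.mulVec x) ∧
      l2norm (Φ.mulVec x) ≤ (1 + ε) * l2norm x) :
    Φ ∈ nearOrthoSet ε X Y := by
  have hcol : ∀ j, (Pi.single j 1 : Fin n → ℝ) ∈ W →
      (1 - ε) ^ 2 ≤ ∑ i, Φ i j ^ 2 ∧ ∑ i, Φ i j ^ 2 ≤ (1 + ε) ^ 2 := by
    intro j hj
    have h := sq_embedding hε1 (hΦ _ hj)
    simpa [Pi.single_apply, Matrix.mulVec_single_one] using h
  refine ⟨⟨fun a => hcol _ (hX a), fun b => hcol _ (hY b)⟩, fun a b hab => ?_⟩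
  have h := (sq_embedding hε1 (hΦ _ (W.add_mem (hX a) (hY b)))).2
  have hx : ∑ j, (Pi.single (X a) 1 + Pi.single (Y b) 1 : Fin n → ℝ) j ^ 2 = 2 := by
    simp only [Pi.add_apply, Pi.single_apply, add_sq, Finset.sum_add_distrib]
    simp [hab.symm]
    norm_num
  rw [hx, Matrix.mulVec_add, Matrix.mulVec_single_one, Matrix.mulVec_single_one] at h
  simp only [Pi.add_apply, Matrix.col_apply, add_sq, Finset.sum_add_distrib, mul_assoc,
    ← Finset.mul_sum] at h
  have h1 := (hcol _ (hX a)).1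
  have h2 := (hcol _ (hY b)).1
  nlinarith

lemma le_of_embedding {Φ : Matrix (Fin m) (Fin n) ℝ} {ε : ℝ} (hε1 : ε < 1)
    (W : Submodule ℝ (Fin n → ℝ))
    (hΦ : ∀ x ∈ W, (1 - ε) * l2norm x ≤ l2norm (Φ.mulVec x)) : Module.finrank ℝ W ≤ m := by
  have hinj : Function.Injective (Φ.mulVecLin.comp W.subtype) := by
    rw [injective_iff_map_eq_zero]
    rintro ⟨x, hx⟩ h0
    have h0' : Φ.mulVec x = 0 := h0
    have h := hΦ x hx
    have hx0 : l2norm x ^ 2 = 0 := by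
      rw [h0', show l2norm (0 : Fin m → ℝ) = 0 by simp [l2norm]] at h
      have := l2norm_nonneg x
      nlinarith
    rw [l2norm_sq, Finset.sum_eq_zero_iff_of_nonneg fun _ _ => sq_nonneg _] at hx0
    exact Subtype.ext (funext fun j => by simpa using hx0 j (Finset.mem_univ j))
  simpa using LinearMap.finrank_le_finrank_of_injective hinj

open Finset in
/-- First moment method: if finitely many events each have probability at least `q`, some outcome
outside a null set lies in a `q`-fraction of them. -/
lemma exists_le_expect_indicator {α T : Type*} [MeasurableSpace α] [Fintype T] [Nonempty T]
    (μ : Measure α) [IsProbabilityMeasure μ] {p : α → Prop} (hp : ∀ᵐ x ∂μ, p x)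
    (S : T → Set α) (hS : ∀ t, MeasurableSet (S t)) {q : ℝ}
    (hq : ∀ t, ENNReal.ofReal q ≤ μ (S t)) :
    ∃ x, p x ∧ q ≤ 𝔼 t, (S t).indicator (1 : α → ℝ) x := by
  have hint : ∀ t, Integrable ((S t).indicator (1 : α → ℝ)) μ :=
    fun t => (integrable_const (1 : ℝ)).indicator (hS t)
  have hint' : Integrable (fun x => 𝔼 t, (S t).indicator (1 : α → ℝ) x) μ := by
    simp only [Fintype.expect_eq_sum_div_card]
    exact (integrable_finsetSum _ fun t _ => hint t).div_const _
  obtain ⟨x, hx, hle⟩ := exists_notMem_null_integral_le hint' hp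
  refine ⟨x, by simpa using hx, le_trans ?_ hle⟩
  simp only [Fintype.expect_eq_sum_div_card]
  rw [integral_div, integral_finsetSum _ fun t _ => hint t, ← Fintype.expect_eq_sum_div_card]
  refine le_expect univ_nonempty fun t _ => ?_
  rw [integral_indicator_one (hS t)]
  exact (ENNReal.ofReal_le_iff_le_toReal (measure_ne_top μ _)).1 (hq t)

end Embedding

theorem stmt5 :
    ∃ c : ℝ, 0 < c ∧ ∃ d₀ : ℕ,
      ∀ (d n m s : ℕ) (ε δ : ℝ) (D : Measure (Matrix (Fin m) (Fin n) ℝ)),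
        IsProbabilityMeasure D →
        d₀ ≤ d → 100 * d ^ 2 ≤ n →
        ε ∈ Set.Ioo (0:ℝ) (1/3) → 0 ≤ δ → δ ≤ 1/100 →
        IsOSE d ε δ D →
        ColSparse s D →
        (m : ℝ) ≤ ε ^ 2 * ((d : ℝ) * ((d : ℝ) - 1)) / 32 →
        c / ε ≤ (s : ℝ) := by
  refine ⟨1 / 72, by norm_num, 2, ?_⟩
  intro d n m s ε δ D hD hd hn hε _ hδ hOSE hsp hm
  obtain ⟨hε0, hε3⟩ := hε
  by_contra! hs
  have hsε : ε * s < 1 / 72 := by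
    rw [lt_div_iff₀ hε0] at hs
    linarith
  have hdn : d ≤ n := by nlinarith
  have hδ' : ENNReal.ofReal (99 / 100) ≤ ENNReal.ofReal (1 - δ) :=
    ENNReal.ofReal_le_ofReal (by linarith)
  have hdm : d ≤ m := by
    obtain ⟨W, hW, -⟩ := exists_submodule_single_mem hdn ∅ (by simp)
    have hpos : 0 < D {Φ | ∀ x ∈ W, (1 - ε) * l2norm x ≤ l2norm (Φ.mulVec x) ∧
        l2norm (Φ.mulVec x) ≤ (1 + ε) * l2norm x} :=
      (ENNReal.ofReal_pos.2 (by norm_num)).trans_le (hδ'.trans (hOSE W hW))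
    obtain ⟨Φ, hΦ⟩ := nonempty_of_measure_ne_zero hpos.ne'
    exact hW ▸ le_of_embedding (by linarith) W fun x hx => (hΦ x hx).1
  obtain ⟨k, hk⟩ : ∃ k, k = d / 2 := ⟨_, rfl⟩
  have hkpos : 0 < k := by lia
  have h2k : 2 * k ≤ d := by lia
  have hn0 : 0 < n := by lia
  have : Nonempty (Fin n) := ⟨⟨0, hn0⟩⟩
  have hprob : ∀ t : (Fin k → Fin n) × (Fin k → Fin n),
      ENNReal.ofReal (99 / 100) ≤ D (nearOrthoSet ε t.1 t.2) := by
    rintro ⟨X, Y⟩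
    obtain ⟨W, hW, hmem⟩ := exists_submodule_single_mem hdn
      (Finset.univ.image X ∪ Finset.univ.image Y) (by
        have hX := Finset.card_image_le (s := Finset.univ) (f := X)
        have hY := Finset.card_image_le (s := Finset.univ) (f := Y)
        rw [Finset.card_univ, Fintype.card_fin] at hX hY
        exact (Finset.card_union_le _ _).trans (by lia))
    refine hδ'.trans ((hOSE W hW).trans (measure_mono fun Φ hΦ => ?_))
    exact mem_nearOrthoSet_of_embedding (by linarith) X Y W
      (fun a => hmem _ (by simp)) (fun b => hmem _ (by simp)) hΦ
  obtain ⟨Φ, hΦ, hE⟩ := exists_le_expect_indicator D hsp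
    (fun t : (Fin k → Fin n) × (Fin k → Fin n) => nearOrthoSet ε t.1 t.2)
    (fun t => measurableSet_nearOrthoSet ε t.1 t.2) hprob
  rw [← Finset.univ_product_univ, Finset.expect_product] at hE
  have hdk : (d : ℝ) ≤ 2 * k + 1 := by
    have : d ≤ 2 * k + 1 := by lia
    exact_mod_cast this
  have hdR : (2 : ℝ) ≤ d := by exact_mod_cast hd
  have hk1 : (1 : ℝ) ≤ k := by exact_mod_cast hkpos
  have hnR : 100 * (d : ℝ) ^ 2 ≤ n := by exact_mod_cast hn
  have hdd : (d : ℝ) * (d - 1) ≤ 8 * k ^ 2 := by nlinarith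
  refine not_le_expect_nearOrtho Φ ⟨hε0, hε3⟩ hΦ hsε hkpos (h2k.trans hdm) ?_ ?_ hE
  · nlinarith [mul_le_mul_of_nonneg_left hdd (sq_nonneg ε)]
  · have : (d : ℝ) * (d - 1) ≤ n / 100 := by nlinarith
    nlinarith [mul_le_mul_of_nonneg_left this (sq_nonneg ε)]
end

section
/- Let α ∈ (0, 1). There exists d₀ (depending on α) such that for all d ≥ d₀ the following holds. Suppose d balls are thrown independently into m bins, where in each throw bin i receives the ball with probability p_i (p₁, …, p_m ≥ 0, Σᵢ pᵢ = 1), and m ≤ d^{1+γ} with (10 log log d)/(α log d) < γ < 1/12. Then with probability at least 99/100, there exist at least d^{1−α}/2 pairwise-disjoint groups of balls, each of size at least α/(4γ), such that all balls within the same group land in the same bin. -/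
open MeasureTheory

/-- The expectation of `F` over `n` independent draws with weights `p`. -/
noncomputable def drawMean {ι : Type*} [Fintype ι] (p : ι → ℝ) (n : ℕ)
    (F : (Fin n → ι) → ℝ) : ℝ :=
  ∑ f : Fin n → ι, (∏ i, p (f i)) * F f

section drawMean

variable {ι : Type*} [Fintype ι] {p : ι → ℝ} {n : ℕ}

lemma drawMean_succ (p : ι → ℝ) (F : (Fin (n + 1) → ι) → ℝ) :
    drawMean p (n + 1) F = ∑ a, p a * drawMean p n fun f => F (Fin.cons a f) := by
  unfold drawMean
  rw [← (Fin.consEquiv fun _ => ι).sum_comp, Fintype.sum_prod_type]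
  refine Finset.sum_congr rfl fun a _ => ?_
  rw [Finset.mul_sum]
  refine Finset.sum_congr rfl fun f _ => ?_
  simp [Fin.consEquiv, Fin.prod_univ_succ, mul_assoc]

lemma drawMean_mono (hp : ∀ a, 0 ≤ p a) {F G : (Fin n → ι) → ℝ} (h : ∀ f, F f ≤ G f) :
    drawMean p n F ≤ drawMean p n G :=
  Finset.sum_le_sum fun f _ =>
    mul_le_mul_of_nonneg_left (h f) (Finset.prod_nonneg fun _ _ => hp _)

lemma drawMean_add (F G : (Fin n → ι) → ℝ) :
    drawMean p n (fun f => F f + G f) = drawMean p n F + drawMean p n G := by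
  simp [drawMean, mul_add, Finset.sum_add_distrib]

lemma drawMean_const_mul (c : ℝ) (F : (Fin n → ι) → ℝ) :
    drawMean p n (fun f => c * F f) = c * drawMean p n F := by
  simp only [drawMean, Finset.mul_sum]
  exact Finset.sum_congr rfl fun f _ => by ring

lemma drawMean_const (hp : ∑ a, p a = 1) (c : ℝ) : drawMean p n (fun _ => c) = c := by
  induction n with
  | zero => simp [drawMean]
  | succ n ih => rw [drawMean_succ]; simp only [ih]; rw [← Finset.sum_mul, hp, one_mul]

lemma drawMean_sum {κ : Type*} (s : Finset κ) (F : κ → (Fin n → ι) → ℝ) :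
    drawMean p n (fun f => ∑ b ∈ s, F b f) = ∑ b ∈ s, drawMean p n (F b) := by
  simp only [drawMean, Finset.mul_sum]
  exact Finset.sum_comm

/-- Efron–Stein: a function with unit bounded differences has variance at most `n`. -/
lemma drawMean_sq_le (hp : ∀ a, 0 ≤ p a) (hp1 : ∑ a, p a = 1) (F : (Fin n → ι) → ℝ)
    (hF : ∀ f f' : Fin n → ι, (∃ i, ∀ j, j ≠ i → f j = f' j) → F f ≤ F f' + 1) :
    drawMean p n (fun f => F f ^ 2) ≤ n + drawMean p n F ^ 2 := by
  induction n with
  | zero => simp [drawMean]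
  | succ n ih =>
    simp only [drawMean_succ p]
    set g : ι → ℝ := fun a => drawMean p n fun f => F (Fin.cons a f) with hg
    have hih : ∀ a, drawMean p n (fun f => F (Fin.cons a f) ^ 2) ≤ n + g a ^ 2 := by
      intro a
      refine ih _ ?_
      rintro f f' ⟨i, hi⟩
      refine hF _ _ ⟨i.succ, fun j hj => ?_⟩
      induction j using Fin.cases with
      | zero => simp
      | succ j => simpa using hi j (by simpa using hj)
    have hdiff : ∀ a b, g a ≤ g b + 1 := by
      intro a b
      rw [← drawMean_const (p := p) (n := n) hp1 1, hg]
      simp only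
      rw [← drawMean_add]
      refine drawMean_mono hp fun f => hF _ _ ⟨0, fun j hj => ?_⟩
      induction j using Fin.cases with
      | zero => exact absurd rfl hj
      | succ j => simp
    set e := ∑ a, p a * g a with he
    have hdev : ∀ a, (g a - e) ^ 2 ≤ 1 := by
      intro a
      have h1 : g a ≤ e + 1 := by
        calc g a = ∑ b, p b * g a := by rw [← Finset.sum_mul, hp1, one_mul]
          _ ≤ ∑ b, p b * (g b + 1) :=
            Finset.sum_le_sum fun b _ => mul_le_mul_of_nonneg_left (hdiff a b) (hp b)
          _ = e + 1 := by simp only [mul_add, Finset.sum_add_distrib, mul_one, hp1, he]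
      have h2 : e ≤ g a + 1 := by
        calc e ≤ ∑ b, p b * (g a + 1) :=
            Finset.sum_le_sum fun b _ => mul_le_mul_of_nonneg_left (hdiff b a) (hp b)
          _ = g a + 1 := by rw [← Finset.sum_mul, hp1, one_mul]
      nlinarith
    have hvar : ∑ a, p a * g a ^ 2 ≤ e ^ 2 + 1 := by
      have h : ∑ a, p a * (g a - e) ^ 2 ≤ 1 := by
        calc _ ≤ ∑ a, p a * 1 :=
              Finset.sum_le_sum fun b _ => mul_le_mul_of_nonneg_left (hdev b) (hp b)
          _ = 1 := by simp [hp1]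
      have h' : ∑ a, p a * (g a - e) ^ 2 = ∑ a, p a * g a ^ 2 - 2 * e * e + e ^ 2 := by
        calc _ = ∑ a, (p a * g a ^ 2 - 2 * e * (p a * g a) + p a * e ^ 2) :=
              Finset.sum_congr rfl fun a _ => by ring
          _ = _ := by
            rw [Finset.sum_add_distrib, Finset.sum_sub_distrib, ← Finset.mul_sum,
              ← Finset.sum_mul, hp1, one_mul]
      nlinarith
    calc _ ≤ ∑ a, p a * (n + g a ^ 2) :=
          Finset.sum_le_sum fun a _ => mul_le_mul_of_nonneg_left (hih a) (hp a)
      _ = n + ∑ a, p a * g a ^ 2 := by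
        simp only [mul_add, Finset.sum_add_distrib]
        rw [← Finset.sum_mul, hp1, one_mul]
      _ ≤ _ := by push_cast; linarith

/-- Chebyshev's inequality for functions with unit bounded differences. -/
lemma drawMean_indicator_le (hp : ∀ a, 0 ≤ p a) (hp1 : ∑ a, p a = 1) (F : (Fin n → ι) → ℝ)
    (hF : ∀ f f' : Fin n → ι, (∃ i, ∀ j, j ≠ i → f j = f' j) → F f ≤ F f' + 1)
    {T : ℝ} (hT : T ≤ drawMean p n F / 2) (hn : 400 * (n : ℝ) ≤ drawMean p n F ^ 2)
    (hpos : 0 < drawMean p n F) :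
    drawMean p n (Set.indicator {f | F f < T} 1) ≤ 1 / 100 := by
  set e := drawMean p n F with he
  have hvar : drawMean p n (fun f => (F f - e) ^ 2) ≤ n := by
    have : drawMean p n (fun f => (F f - e) ^ 2)
        = drawMean p n (fun f => F f ^ 2) - e ^ 2 := by
      calc _ = drawMean p n (fun f => (F f ^ 2 + (-2 * e) * F f) + e ^ 2) := by
            congr 1; funext f; ring
        _ = _ := by
          rw [drawMean_add, drawMean_add, drawMean_const_mul, drawMean_const hp1]; ring
    have := drawMean_sq_le hp hp1 F hF
    linarith
  have hmarkov : drawMean p n (fun f => (e / 2) ^ 2 * Set.indicator {f | F f < T} 1 f) ≤ n := by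
    refine (drawMean_mono hp fun f => ?_).trans hvar
    by_cases hf : F f < T
    · simp only [Set.indicator, Set.mem_ofPred_eq, hf, if_true, Pi.one_apply]
      nlinarith
    · simp only [Set.indicator, Set.mem_ofPred_eq, hf, if_false]
      nlinarith [sq_nonneg (F f - e)]
  rw [drawMean_const_mul] at hmarkov
  have : 0 < e ^ 2 := by positivity
  by_contra! hcon
  nlinarith

end drawMean

/-- One Bernoulli step: the mean of `φ` after an increment with probability `q`. -/
def bernStep (q : ℝ) (φ : ℕ → ℝ) : ℕ → ℝ := fun r => q * φ (r + 1) + (1 - q) * φ r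

section bernStep

variable {q : ℝ} {φ ψ : ℕ → ℝ}

lemma bernStep_le (h0 : 0 ≤ q) (h1 : q ≤ 1) (h : φ ≤ ψ) : bernStep q φ ≤ bernStep q ψ :=
  fun r => add_le_add (mul_le_mul_of_nonneg_left (h _) h0)
    (mul_le_mul_of_nonneg_left (h _) (by linarith))

lemma bernStep_mono (h0 : 0 ≤ q) (h1 : q ≤ 1) (h : Monotone φ) : Monotone (bernStep q φ) :=
  fun r s hrs => add_le_add (mul_le_mul_of_nonneg_left (h (by omega)) h0)
    (mul_le_mul_of_nonneg_left (h hrs) (by linarith))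

lemma bernStep_iterate_mono (h0 : 0 ≤ q) (h1 : q ≤ 1) (h : Monotone φ) (n : ℕ) :
    Monotone ((bernStep q)^[n] φ) := by
  induction n with
  | zero => exact h
  | succ n ih => rw [Function.iterate_succ_apply']; exact bernStep_mono h0 h1 ih

lemma bernStep_iterate_le (h0 : 0 ≤ q) (h1 : q ≤ 1) (h : φ ≤ ψ) (n : ℕ) :
    (bernStep q)^[n] φ ≤ (bernStep q)^[n] ψ := by
  induction n with
  | zero => exact h
  | succ n ih => simp only [Function.iterate_succ_apply']; exact bernStep_le h0 h1 ih

lemma le_bernStep_iterate (h0 : 0 ≤ q) (h1 : q ≤ 1) (h : Monotone φ) (n : ℕ) :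
    φ ≤ (bernStep q)^[n] φ := by
  induction n with
  | zero => exact le_rfl
  | succ n ih =>
    rw [Function.iterate_succ_apply']
    refine ih.trans fun r => ?_
    have := bernStep_iterate_mono h0 h1 h n (Nat.le_succ r)
    simp only [bernStep, Nat.succ_eq_add_one] at this ⊢
    nlinarith

/-- `t` Bernoulli steps give at least one increment with probability `1 - (1 - q) ^ t`. -/
lemma bernStep_le_iterate (h0 : 0 ≤ q) (h1 : q ≤ 1) (h : Monotone φ) (t : ℕ) :
    bernStep (1 - (1 - q) ^ t) φ ≤ (bernStep q)^[t] φ := by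
  induction t with
  | zero => intro r; simp [bernStep]
  | succ t ih =>
    rw [Function.iterate_succ_apply']
    intro r
    have hr := ih r
    have hr' := le_bernStep_iterate h0 h1 h t (r + 1)
    simp only [bernStep] at hr ⊢
    have e1 := mul_le_mul_of_nonneg_left hr (sub_nonneg.2 h1)
    have e2 := mul_le_mul_of_nonneg_left hr' h0
    rw [pow_succ]
    linarith

/-- `j` stages of `t` Bernoulli steps give at least `j` increments with probability at least the
probability that every stage contains an increment. -/
lemma iterate_stage_ge (h0 : 0 ≤ q) (h1 : q ≤ 1) (h : Monotone φ) (t j r : ℕ) :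
    (1 - (1 - q) ^ t) ^ j * φ (r + j) + (1 - (1 - (1 - q) ^ t) ^ j) * φ r
      ≤ (bernStep q)^[j * t] φ r := by
  set s := 1 - (1 - q) ^ t with hs
  have hpow0 : 0 ≤ (1 - q) ^ t := pow_nonneg (by linarith) _
  have hpow1 : (1 - q) ^ t ≤ 1 := pow_le_one₀ (by linarith) (by linarith)
  have hs0 : 0 ≤ s := by linarith
  have hs1 : s ≤ 1 := by linarith
  induction j generalizing r with
  | zero => simp
  | succ j ih =>
    have hstep := bernStep_le_iterate h0 h1 (bernStep_iterate_mono h0 h1 h (j * t)) t r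
    rw [← Function.iterate_add_apply, ← hs] at hstep
    rw [show (j + 1) * t = t + j * t by ring]
    refine le_trans ?_ hstep
    simp only [bernStep]
    have e1 := mul_le_mul_of_nonneg_left (ih (r + 1)) hs0
    have e2 := mul_le_mul_of_nonneg_left (le_bernStep_iterate h0 h1 h (j * t) r)
      (sub_nonneg.2 hs1)
    have e3 : φ r ≤ φ (r + 1) := h (Nat.le_succ r)
    have e4 : s ^ j ≤ 1 := pow_le_one₀ hs0 hs1
    have e5 := mul_le_mul_of_nonneg_left e3 (mul_nonneg hs0 (sub_nonneg.2 e4))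
    rw [show r + (j + 1) = r + 1 + j by ring, pow_succ]
    linarith

lemma bernStep_iterate_add_const (c : ℝ) (n : ℕ) :
    (bernStep q)^[n] (fun r => φ r + c) = fun r => (bernStep q)^[n] φ r + c := by
  induction n with
  | zero => rfl
  | succ n ih =>
    rw [Function.iterate_succ_apply', Function.iterate_succ_apply', ih]
    funext r
    simp only [bernStep]
    ring

lemma natDiv_mono (k : ℕ) : Monotone fun r : ℕ => ((r / k : ℕ) : ℝ) :=
  fun _ _ h => Nat.cast_le.2 (Nat.div_le_div_right h)

/-- The expected number of complete `k`-groups in `n` Bernoulli trials. -/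
lemma iterate_natDiv_ge (h0 : 0 ≤ q) (h1 : q ≤ 1) {k : ℕ} (hk : 0 < k) (t n : ℕ) :
    ((n / (k * t) : ℕ) : ℝ) * (1 - (1 - q) ^ t) ^ k
      ≤ (bernStep q)^[n] (fun r => ((r / k : ℕ) : ℝ)) 0 := by
  set φ : ℕ → ℝ := fun r => ((r / k : ℕ) : ℝ) with hφ
  have hφm : Monotone φ := natDiv_mono k
  set c := (1 - (1 - q) ^ t) ^ k with hc
  have hblock : (fun r => φ r + c) ≤ (bernStep q)^[k * t] φ := by
    intro r
    have h := iterate_stage_ge h0 h1 hφm t k r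
    have : φ (r + k) = φ r + 1 := by simp [hφ, Nat.add_div_right _ hk]
    rw [this, ← hc] at h
    simp only
    linarith
  have hblocks : ∀ j : ℕ, (fun r => φ r + j * c) ≤ (bernStep q)^[j * (k * t)] φ := by
    intro j
    induction j with
    | zero => intro r; simp
    | succ j ih =>
      intro r
      rw [show (j + 1) * (k * t) = k * t + j * (k * t) by ring, Function.iterate_add_apply]
      refine le_trans ?_ (bernStep_iterate_le h0 h1 ih (k * t) r)
      rw [bernStep_iterate_add_const]
      have := hblock r
      simp only at this ⊢
      push_cast
      linarith
  have hfin := le_bernStep_iterate h0 h1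
    (bernStep_iterate_mono h0 h1 hφm (n / (k * t) * (k * t))) (n % (k * t)) 0
  rw [← Function.iterate_add_apply, Nat.mod_add_div'] at hfin
  have := hblocks (n / (k * t)) 0
  simp only [hφ, Nat.zero_div, Nat.cast_zero, zero_add] at this
  exact this.trans hfin

end bernStep

lemma half_mul_le_one_sub_pow {q : ℝ} (h0 : 0 ≤ q) (h1 : q ≤ 1) {t : ℕ} (ht : t * q ≤ 1) :
    t * q / 2 ≤ 1 - (1 - q) ^ t := by
  have hb : 1 + t * q ≤ (1 + q) ^ t := one_add_mul_le_pow (by linarith) t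
  have hz : 0 ≤ (1 - q) ^ t := pow_nonneg (by linarith) _
  have hprod : (1 - q) ^ t * (1 + q) ^ t ≤ 1 := by
    rw [← mul_pow]
    exact pow_le_one₀ (by nlinarith) (by nlinarith)
  have h2 := mul_le_mul_of_nonneg_left hb hz
  have : 0 ≤ t * q := by positivity
  by_contra! hcon
  nlinarith

/-- The number of balls in bin `b`. -/
def binLoad {ι : Type*} [DecidableEq ι] {n : ℕ} (f : Fin n → ι) (b : ι) : ℕ :=
  (Finset.univ.filter fun i => f i = b).card

section binLoad

variable {ι : Type*} [DecidableEq ι] {n : ℕ}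

lemma binLoad_cons (a b : ι) (f : Fin n → ι) :
    binLoad (Fin.cons a f : Fin (n + 1) → ι) b = (if a = b then 1 else 0) + binLoad f b := by
  simp only [binLoad, Finset.card_filter, Fin.sum_univ_succ, Fin.cons_zero, Fin.cons_succ]

lemma drawMean_binLoad [Fintype ι] {p : ι → ℝ} (hp1 : ∑ a, p a = 1) (b : ι) (φ : ℕ → ℝ)
    (r : ℕ) : drawMean p n (fun f => φ (r + binLoad f b)) = (bernStep (p b))^[n] φ r := by
  induction n generalizing r with
  | zero => simp [drawMean, binLoad]
  | succ n ih =>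
    rw [drawMean_succ, Function.iterate_succ_apply', ← Finset.add_sum_erase _ _ (Finset.mem_univ b)]
    have hrest : ∑ a ∈ Finset.univ.erase b,
        p a * drawMean p n (fun f => φ (r + binLoad (Fin.cons a f : Fin (n + 1) → ι) b))
        = ∑ a ∈ Finset.univ.erase b, p a * (bernStep (p b))^[n] φ r := by
      refine Finset.sum_congr rfl fun a ha => ?_
      simp only [binLoad_cons, Finset.ne_of_mem_erase ha, if_false, zero_add, ih]
    have hsum : ∑ a ∈ Finset.univ.erase b, p a = 1 - p b := by
      rw [← hp1, ← Finset.add_sum_erase _ _ (Finset.mem_univ b)]; ring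
    rw [hrest, ← Finset.sum_mul, hsum]
    simp only [binLoad_cons, if_true, ← add_assoc, ih, bernStep]

lemma sum_binLoad_div_le [Fintype ι] (k : ℕ) (f f' : Fin n → ι)
    (h : ∃ i, ∀ j, j ≠ i → f j = f' j) :
    ∑ b, binLoad f b / k ≤ ∑ b, binLoad f' b / k + 1 := by
  obtain ⟨i, hi⟩ := h
  have hle : ∀ b, binLoad f b / k ≤ binLoad f' b / k + if f i = b then 1 else 0 := by
    intro b
    by_cases hb : f i = b
    · have hcard : binLoad f b ≤ binLoad f' b + 1 := by
        unfold binLoad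
        refine (Finset.card_le_card (t := insert i (Finset.univ.filter fun j => f' j = b))
          fun j hj => ?_).trans (Finset.card_insert_le _ _)
        by_cases hji : j = i
        · simp [hji]
        · simp only [Finset.mem_filter, Finset.mem_univ, true_and] at hj
          simp [hji, ← hi j hji, hj]
      rw [if_pos hb]
      rcases Nat.eq_zero_or_pos k with rfl | hk
      · simp
      · rw [← Nat.add_div_right _ hk]
        exact Nat.div_le_div_right (by omega)
    · rw [if_neg hb, add_zero]
      refine Nat.div_le_div_right (Finset.card_le_card fun j hj => ?_)
      simp only [Finset.mem_filter, Finset.mem_univ, true_and] at hj ⊢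
      have hji : j ≠ i := by rintro rfl; exact hb hj
      rw [← hi j hji, hj]
  calc _ ≤ ∑ b, (binLoad f' b / k + if f i = b then 1 else 0) :=
        Finset.sum_le_sum fun b _ => hle b
    _ = _ := by simp [Finset.sum_add_distrib]

lemma exists_disjoint_groups [Fintype ι] {β : Type*} [DecidableEq β] (f : β → ι) {k : ℕ}
    (hk : 0 < k) (N : ℕ) (S : Finset β) (hN : N ≤ ∑ b, (S.filter fun i => f i = b).card / k) :
    ∃ G : Finset (Finset β), (G : Set (Finset β)).PairwiseDisjoint id ∧
      (∀ g ∈ G, g ⊆ S ∧ g.card = k ∧ ∃ b, ∀ i ∈ g, f i = b) ∧ G.card = N := by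
  induction N generalizing S with
  | zero => exact ⟨∅, by simp⟩
  | succ N ih =>
    obtain ⟨b, -, hb⟩ : ∃ b ∈ Finset.univ, (S.filter fun i => f i = b).card / k ≠ 0 := by
      refine Finset.exists_ne_zero_of_sum_ne_zero ?_
      omega
    have hkb : k ≤ (S.filter fun i => f i = b).card := by
      by_contra! hlt
      exact hb (Nat.div_eq_of_lt hlt)
    obtain ⟨g, hg, hgk⟩ := Finset.exists_subset_card_eq hkb
    have hgf : ∀ i ∈ g, i ∈ S ∧ f i = b := fun i hi => Finset.mem_filter.1 (hg hi)
    have hle : ∀ c, (S.filter fun i => f i = c).card / k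
        ≤ ((S \ g).filter fun i => f i = c).card / k + if b = c then 1 else 0 := by
      intro c
      by_cases hc : b = c
      · subst hc
        rw [if_pos rfl, ← Nat.add_div_right _ hk]
        refine Nat.div_le_div_right ?_
        rw [← hgk]
        refine (Finset.card_le_card fun i hi => ?_).trans (Finset.card_union_le _ _)
        simp only [Finset.mem_filter, Finset.mem_union, Finset.mem_sdiff] at hi ⊢
        tauto
      · rw [if_neg hc, add_zero]
        refine Nat.div_le_div_right (Finset.card_le_card fun i hi => ?_)
        simp only [Finset.mem_filter, Finset.mem_sdiff] at hi ⊢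
        exact ⟨⟨hi.1, fun hig => hc ((hgf i hig).2.symm.trans hi.2)⟩, hi.2⟩
    have hsum := Finset.sum_le_sum fun c (_ : c ∈ Finset.univ) => hle c
    rw [Finset.sum_add_distrib, Finset.sum_ite_eq, if_pos (Finset.mem_univ b)] at hsum
    obtain ⟨G, hGd, hG, hGN⟩ := ih (S \ g) (by omega)
    have hdisj : ∀ g' ∈ G, Disjoint g g' := fun g' hg' =>
      (Finset.disjoint_of_subset_left (hG g' hg').1 Finset.sdiff_disjoint).symm
    have hgG : g ∉ G := by
      intro h
      have := hdisj g h
      rw [disjoint_self, Finset.bot_eq_empty] at this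
      simp [this] at hgk
      omega
    refine ⟨insert g G, ?_, ?_, by rw [Finset.card_insert_of_notMem hgG, hGN]⟩
    · rw [Finset.coe_insert]
      exact hGd.insert fun g' hg' _ => hdisj g' hg'
    · intro g' hg'
      rcases Finset.mem_insert.1 hg' with rfl | hg'
      · exact ⟨fun i hi => (hgf i hi).1, hgk, b, fun i hi => (hgf i hi).2⟩
      · obtain ⟨h1, h2, h3⟩ := hG g' hg'
        exact ⟨h1.trans Finset.sdiff_subset, h2, h3⟩

end binLoad

lemma half_div_le_natDiv {a b : ℕ} (hb : 0 < b) (hab : b ≤ a) :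
    (a : ℝ) / (2 * b) ≤ ((a / b : ℕ) : ℝ) := by
  have h1 : 1 ≤ a / b := (Nat.one_le_div_iff hb).2 hab
  have h2 : a ≤ 2 * b * (a / b) := by
    have := Nat.div_add_mod a b
    have := Nat.mod_lt a hb
    nlinarith
  have hb' : (0 : ℝ) < b := Nat.cast_pos.2 hb
  rw [div_le_iff₀ (by positivity)]
  have : (a : ℝ) ≤ 2 * b * (a / b : ℕ) := by exact_mod_cast h2
  linarith

/-- A lower bound for the expected number of complete `k`-groups in a bin of probability `q`. -/
lemma mean_groups_ge {q y : ℝ} {k d m : ℕ} (h1 : q ≤ 1) (hm : 0 < m)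
    (hq : 1 / (2 * (m : ℝ)) ≤ q) (hk : 0 < k) (hkd : k ≤ d) (hy0 : 0 ≤ y) (hy1 : y ≤ 1)
    (hmy : m * y ≤ d) :
    (d / (4 * k) * (y / (8 * k)) ^ (k - 1)) * q
      ≤ (bernStep q)^[d] (fun r => ((r / k : ℕ) : ℝ)) 0 := by
  have hm' : (0 : ℝ) < m := Nat.cast_pos.2 hm
  have hk' : (1 : ℝ) ≤ k := Nat.one_le_cast.2 hk
  have hq0 : 0 < q := lt_of_lt_of_le (by positivity) hq
  have hfl : 1 ≤ ⌊1 / q⌋₊ := Nat.le_floor (by rw [Nat.cast_one, le_div_iff₀ hq0]; linarith)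
  have hdk : 1 ≤ d / k := (Nat.one_le_div_iff hk).2 hkd
  obtain ⟨t, ht⟩ : ∃ t, t = min (d / k) ⌊1 / q⌋₊ := ⟨_, rfl⟩
  have ht1 : 1 ≤ t := by rw [ht]; exact le_min hdk hfl
  have htq : t * q ≤ 1 := by
    rw [← le_div_iff₀ hq0]
    exact (Nat.cast_le.2 (ht ▸ min_le_right _ _)).trans (Nat.floor_le (by positivity))
  have hkt : k * t ≤ d :=
    (Nat.mul_le_mul_left k (ht ▸ min_le_left _ _)).trans (Nat.mul_div_le d k)
  have hlow : y / (8 * k) ≤ t * q / 2 := by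
    rw [div_le_iff₀ (by positivity)]
    rcases min_choice (d / k) ⌊1 / q⌋₊ with h | h
    · have h2 := half_div_le_natDiv hk hkd
      rw [← h, ← ht, div_le_iff₀ (by positivity)] at h2
      rw [div_le_iff₀ (by positivity)] at hq
      have h3 : m * y ≤ m * (t * q / 2 * (8 * k)) := by
        have := mul_le_mul_of_nonneg_left hq (show (0 : ℝ) ≤ t * (2 * k) by positivity)
        linarith
      exact le_of_mul_le_mul_left h3 hm'
    · have h2 := Nat.lt_floor_add_one (1 / q)
      rw [← h, ← ht, div_lt_iff₀ hq0] at h2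
      have h3 : q ≤ t * q := le_mul_of_one_le_left hq0.le (Nat.one_le_cast.2 ht1)
      nlinarith
  have ht' : (0 : ℝ) < t := Nat.cast_pos.2 ht1
  have hdiv := half_div_le_natDiv (Nat.mul_pos hk ht1) hkt
  refine le_trans ?_ (iterate_natDiv_ge hq0.le h1 hk t d)
  calc (d / (4 * k) * (y / (8 * k)) ^ (k - 1)) * q
      = d / (2 * (k * t : ℕ)) * ((y / (8 * k)) ^ (k - 1) * (t * q / 2)) := by
        push_cast; field_simp; ring
    _ ≤ d / (2 * (k * t : ℕ)) * ((t * q / 2) ^ (k - 1) * (t * q / 2)) := by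
        gcongr
    _ = d / (2 * (k * t : ℕ)) * (t * q / 2) ^ k := by
        rw [← pow_succ, Nat.sub_add_cancel hk]
    _ ≤ _ := by
        gcongr
        exact half_mul_le_one_sub_pow hq0.le h1 htq

lemma drawMean_groups_ge {m : ℕ} {p : Fin m → ℝ} {y : ℝ} {k d : ℕ} (hp : ∀ a, 0 ≤ p a)
    (hp1 : ∑ a, p a = 1) (hk : 0 < k) (hkd : k ≤ d) (hy0 : 0 ≤ y) (hy1 : y ≤ 1)
    (hmy : m * y ≤ d) :
    d * y ^ (k - 1) / (8 * k) ^ k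
      ≤ drawMean p d (fun f => ((∑ b, binLoad f b / k : ℕ) : ℝ)) := by
  have hm : 0 < m := by
    rcases Nat.eq_zero_or_pos m with rfl | h
    · simp at hp1
    · exact h
  have hm' : (0 : ℝ) < m := Nat.cast_pos.2 hm
  have hk' : (0 : ℝ) < k := Nat.cast_pos.2 hk
  have hle1 : ∀ a, p a ≤ 1 := fun a =>
    hp1 ▸ Finset.single_le_sum (fun b _ => hp b) (Finset.mem_univ a)
  push_cast
  rw [drawMean_sum]
  set c : ℝ := d / (4 * k) * (y / (8 * k)) ^ (k - 1) with hc
  have hc0 : 0 ≤ c := by positivity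
  have hbin : ∀ b, c * (p b - 1 / (2 * m))
      ≤ drawMean p d (fun f => ((binLoad f b / k : ℕ) : ℝ)) := by
    intro b
    have hmean := drawMean_binLoad (n := d) hp1 b (fun r => ((r / k : ℕ) : ℝ)) 0
    simp only [zero_add] at hmean
    rw [hmean]
    rcases le_total (1 / (2 * (m : ℝ))) (p b) with h | h
    · refine le_trans ?_ (mean_groups_ge (hle1 b) hm h hk hkd hy0 hy1 hmy)
      exact mul_le_mul_of_nonneg_left (sub_le_self _ (by positivity)) hc0
    · refine (mul_nonpos_of_nonneg_of_nonpos hc0 (by linarith)).trans ?_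
      have := le_bernStep_iterate (hp b) (hle1 b) (natDiv_mono k) d 0
      simpa using this
  refine le_trans (le_of_eq ?_) (Finset.sum_le_sum fun b _ => hbin b)
  rw [← Finset.mul_sum, Finset.sum_sub_distrib, hp1, Finset.sum_const, Finset.card_univ,
    Fintype.card_fin, nsmul_eq_mul, hc, div_pow, show (8 * (k : ℝ)) ^ k
      = (8 * k) ^ (k - 1) * (8 * k) by rw [← pow_succ, Nat.sub_add_cancel hk]]
  field_simp
  ring

lemma eventually_log_bounds {α : ℝ} (hα : 0 < α) :
    ∀ᶠ d : ℕ in Filter.atTop, 1600 ≤ Real.log d ∧ 1 ≤ Real.log (Real.log d) ∧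
      Real.log (Real.log d) ≤ α / 10 * Real.log d := by
  have hlog : Filter.Tendsto (fun d : ℕ => Real.log d) Filter.atTop Filter.atTop :=
    Real.tendsto_log_atTop.comp tendsto_natCast_atTop_atTop
  have hlo : ∀ᶠ x : ℝ in Filter.atTop, Real.log x ≤ α / 10 * x := by
    filter_upwards [Real.isLittleO_log_id_atTop.bound (show 0 < α / 10 by positivity),
      Filter.eventually_ge_atTop 0] with x hx hx0
    simpa [abs_of_nonneg hx0] using (le_abs_self _).trans hx
  exact (hlog.eventually_ge_atTop 1600).and
    (((Real.tendsto_log_atTop.comp hlog).eventually_ge_atTop 1).and (hlog.eventually hlo))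

/-- The group size `⌈α / (4γ)⌉` is small enough for the mean number of groups to be large. -/
lemma group_size_bounds {α γ : ℝ} {d k : ℕ} (hα0 : 0 < α) (hα1 : α < 1)
    (hL : 1600 ≤ Real.log d) (hl1 : 1 ≤ Real.log (Real.log d))
    (hl : Real.log (Real.log d) ≤ α / 10 * Real.log d)
    (hγ : 10 * Real.log (Real.log d) / (α * Real.log d) < γ) (hk : k = ⌈α / (4 * γ)⌉₊) :
    0 < γ ∧ 0 < k ∧ k ≤ d ∧
      (d : ℝ) ^ (1 - 3 * α / 8) ≤ d * ((d : ℝ) ^ (-γ)) ^ (k - 1) / (8 * k) ^ k := by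
  set L := Real.log d with hLdef
  set l := Real.log L with hldef
  have hd : (0 : ℝ) < d := by
    rcases Nat.eq_zero_or_pos d with rfl | h
    · simp [hLdef] at hL; norm_num at hL
    · exact Nat.cast_pos.2 h
  have hL0 : 0 < L := by linarith
  have hγ0 : 0 < γ := lt_of_le_of_lt (by positivity) hγ
  have hk0 : 0 < k := hk ▸ Nat.ceil_pos.2 (by positivity)
  have hk' : (1 : ℝ) ≤ k := Nat.one_le_cast.2 hk0
  have hceil : (k : ℝ) - 1 < α / (4 * γ) := by
    have := Nat.ceil_lt_add_one (show 0 ≤ α / (4 * γ) by positivity)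
    rw [← hk] at this
    linarith
  have hγk : γ * (k - 1) ≤ α / 4 := by
    rw [lt_div_iff₀ (by positivity)] at hceil
    linarith
  rw [div_lt_iff₀ (by positivity)] at hγ
  have hkl : (k - 1) * l ≤ α * L / 40 := by
    have h1 : 0 ≤ (k : ℝ) - 1 := by linarith
    have h2 := mul_le_mul_of_nonneg_left hγ.le h1
    have h3 := mul_le_mul_of_nonneg_right hγk (show 0 ≤ α * L by positivity)
    have h4 : α / 4 * (α * L) ≤ 1 / 4 * (α * L) := by gcongr
    linarith
  have h8k : 8 * (k : ℝ) ≤ L := by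
    have h1 : (k : ℝ) - 1 ≤ (k - 1) * l := le_mul_of_one_le_right (by linarith) hl1
    have h2 : α * L ≤ 1 * L := by gcongr
    linarith
  have hLd : L ≤ d := (Real.log_le_sub_one_of_pos hd).trans (by linarith)
  refine ⟨hγ0, hk0, by exact_mod_cast (show (k : ℝ) ≤ d by linarith), ?_⟩
  have hlog8k : Real.log (8 * k) ≤ l := Real.log_le_log (by positivity) h8k
  rw [← Real.log_le_log_iff (by positivity) (by positivity), Real.log_rpow hd,
    Real.log_div (by positivity) (by positivity), Real.log_mul (by positivity) (by positivity),
    Real.log_pow, Real.log_pow, Real.log_rpow hd, Nat.cast_sub hk0, Nat.cast_one, ← hLdef]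
  have h1 : k * Real.log (8 * k) ≤ k * l := by gcongr
  have h2 := mul_le_mul_of_nonneg_right hγk hL0.le
  linarith

lemma four_hundred_mul_le {α : ℝ} {d : ℕ} (hα1 : α < 1) (hL : 1600 ≤ Real.log d) :
    400 * (d : ℝ) ≤ ((d : ℝ) ^ (1 - 3 * α / 8)) ^ 2 := by
  have hd : (0 : ℝ) < d := by
    rcases Nat.eq_zero_or_pos d with rfl | h
    · norm_num at hL
    · exact Nat.cast_pos.2 h
  rw [← Real.log_le_log_iff (by positivity) (by positivity), Real.log_pow, Real.log_rpow hd,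
    Real.log_mul (by norm_num) (by positivity)]
  have := Real.log_le_sub_one_of_pos (show (0 : ℝ) < 400 by norm_num)
  push_cast
  nlinarith

lemma measure_pi_eq_drawMean {m d : ℕ} {p : Fin m → ℝ} {μ : Measure (Fin m)}
    [IsProbabilityMeasure μ] (hp : ∀ a, 0 ≤ p a) (hμ : ∀ a, μ {a} = ENNReal.ofReal (p a))
    (S : Set (Fin d → Fin m)) :
    (Measure.pi fun _ : Fin d => μ) S = ENNReal.ofReal (drawMean p d (S.indicator 1)) := by
  classical
  have hS : S = ((Finset.univ.filter (· ∈ S) : Finset (Fin d → Fin m)) : Set _) := by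
    ext f; simp
  have hw : ∀ f : Fin d → Fin m, 0 ≤ ∏ i, p (f i) := fun f => Finset.prod_nonneg fun _ _ => hp _
  conv_lhs => rw [hS]
  rw [← sum_measure_singleton, Finset.sum_filter, drawMean, ENNReal.ofReal_sum_of_nonneg]
  · refine Finset.sum_congr rfl fun f _ => ?_
    by_cases hf : f ∈ S
    · simp [hf, Measure.pi_singleton, hμ, ENNReal.ofReal_prod_of_nonneg fun i _ => hp (f i)]
    · simp [hf]
  · exact fun f _ => mul_nonneg (hw f) (Set.indicator_nonneg (fun _ _ => zero_le_one) _)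

theorem stmt9 (α : ℝ) (hα : α ∈ Set.Ioo (0:ℝ) 1) :
    ∃ d₀ : ℕ, ∀ (d m : ℕ) (γ : ℝ) (p : Fin m → ℝ) (μ₁ : Measure (Fin m)),
      IsProbabilityMeasure μ₁ →
      (∀ i, 0 ≤ p i) → (∑ i, p i = 1) →
      (∀ i, μ₁ {i} = ENNReal.ofReal (p i)) →
      d₀ ≤ d →
      (m : ℝ) ≤ (d : ℝ) ^ ((1:ℝ) + γ) →
      10 * Real.log (Real.log d) / (α * Real.log d) < γ → γ < 1/12 →
      ENNReal.ofReal (99/100) ≤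
        (Measure.pi fun _ : Fin d => μ₁)
          {f | ∃ G : Finset (Finset (Fin d)),
            (↑G : Set (Finset (Fin d))).PairwiseDisjoint id ∧
            (∀ g ∈ G, α / (4 * γ) ≤ (g.card : ℝ) ∧ ∃ b : Fin m, ∀ i ∈ g, f i = b) ∧
            (d : ℝ) ^ ((1:ℝ) - α) / 2 ≤ (G.card : ℝ)} := by
  obtain ⟨hα0, hα1⟩ := hα
  obtain ⟨d₀, hd₀⟩ := Filter.eventually_atTop.1 (eventually_log_bounds hα0)
  refine ⟨d₀, fun d m γ p μ₁ hμ₁ hp hp1 hμ hd hm hγ _ => ?_⟩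
  obtain ⟨hL, hl1, hl⟩ := hd₀ d hd
  obtain ⟨k, hk⟩ : ∃ k, k = ⌈α / (4 * γ)⌉₊ := ⟨_, rfl⟩
  obtain ⟨hγ0, hk0, hkd, hbound⟩ := group_size_bounds hα0 hα1 hL hl1 hl hγ hk
  have hd1 : (1 : ℝ) ≤ d := Nat.one_le_cast.2 (hk0.trans_le hkd)
  have hd0 : (0 : ℝ) < d := by linarith
  have hmy : m * (d : ℝ) ^ (-γ) ≤ d := by
    calc m * (d : ℝ) ^ (-γ) ≤ (d : ℝ) ^ (1 + γ) * (d : ℝ) ^ (-γ) := by gcongr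
      _ = d := by rw [← Real.rpow_add hd0]; simp
  set X : (Fin d → Fin m) → ℝ := fun f => ((∑ b, binLoad f b / k : ℕ) : ℝ) with hX
  have hmean : (d : ℝ) ^ (1 - 3 * α / 8) ≤ drawMean p d X :=
    hbound.trans (drawMean_groups_ge hp hp1 hk0 hkd (by positivity)
      (Real.rpow_le_one_of_one_le_of_nonpos hd1 (by linarith)) hmy)
  have hpos : 0 < (d : ℝ) ^ (1 - 3 * α / 8) := by positivity
  have hT : (d : ℝ) ^ (1 - α) / 2 ≤ drawMean p d X / 2 := by
    have : (d : ℝ) ^ (1 - α) ≤ (d : ℝ) ^ (1 - 3 * α / 8) :=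
      Real.rpow_le_rpow_of_exponent_le hd1 (by linarith)
    linarith
  have hbad := drawMean_indicator_le hp hp1 X
    (fun f f' h => by simp only [hX]; exact_mod_cast sum_binLoad_div_le k f f' h) hT
    ((four_hundred_mul_le hα1 hL).trans (by gcongr)) (hpos.trans_le hmean)
  rw [measure_pi_eq_drawMean hp hμ]
  refine ENNReal.ofReal_le_ofReal ?_
  set B : Set (Fin d → Fin m) := {f | X f < (d : ℝ) ^ (1 - α) / 2} with hB
  set S : Set (Fin d → Fin m) := {f | ∃ G : Finset (Finset (Fin d)),
    (↑G : Set (Finset (Fin d))).PairwiseDisjoint id ∧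
    (∀ g ∈ G, α / (4 * γ) ≤ (g.card : ℝ) ∧ ∃ b : Fin m, ∀ i ∈ g, f i = b) ∧
    (d : ℝ) ^ ((1:ℝ) - α) / 2 ≤ (G.card : ℝ)} with hS
  have hsub : ∀ f, f ∈ B ∨ f ∈ S := by
    intro f
    by_cases hf : f ∈ B
    · exact Or.inl hf
    · right
      obtain ⟨G, hGd, hG, hGN⟩ := exists_disjoint_groups f hk0 _ Finset.univ le_rfl
      refine ⟨G, hGd, fun g hg => ?_, ?_⟩
      · obtain ⟨-, hgk, hb⟩ := hG g hg
        exact ⟨by rw [hgk, hk]; exact Nat.le_ceil _, hb⟩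
      · rw [hGN]
        exact not_lt.1 hf
  have htotal : (1 : ℝ) ≤ drawMean p d (fun f => B.indicator 1 f + S.indicator 1 f) := by
    rw [← drawMean_const (p := p) (n := d) hp1 1]
    refine drawMean_mono hp fun f => ?_
    have hB0 : (0 : ℝ) ≤ B.indicator 1 f := Set.indicator_nonneg (fun _ _ => zero_le_one) _
    have hS0 : (0 : ℝ) ≤ S.indicator 1 f := Set.indicator_nonneg (fun _ _ => zero_le_one) _
    rcases hsub f with h | h
    · have : B.indicator (1 : (Fin d → Fin m) → ℝ) f = 1 := by simp [h]
      linarith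
    · have : S.indicator (1 : (Fin d → Fin m) → ℝ) f = 1 := by simp [h]
      linarith
  rw [drawMean_add] at htotal
  linarith
end
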